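/- arXiv:0712.2792 — 2 statements merged into one kernel-verified Lean document; each statement's English description precedes it below -/
import Mathlib

section
/- Let q be a fixed permutation pattern of length k ≥ 2, and for each n let X_n be the random variable counting the occurrences (copies) of q in a uniformly random permutation of length n. Then the standardized variable (X_n − E[X_n])/sqrt(Var(X_n)) converges in distribution, as n → ∞, to the standard normal distribution N(0,1). -/
open Finset Filter

/-- The number of occurrences (copies) of the pattern `q` (a permutation of length `k`)
in the permutation `p` of length `n`: the number of strictly increasing sequences of
`k` positions on which the entries of `p` are order-isomorphic to `q`. -/
def occCount {k n : ℕ} (q : Equiv.Perm (Fin k)) (p : Equiv.Perm (Fin n)) : ℕ :=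
  (univ.filter fun ι : Fin k → Fin n =>
    (∀ a b : Fin k, a < b → ι a < ι b) ∧
    (∀ j r : Fin k, q j < q r ↔ p (ι j) < p (ι r))).card

/-- The expectation of the number of occurrences of `q` in a uniformly random
permutation of length `n`. -/
noncomputable def meanOcc (k n : ℕ) (q : Equiv.Perm (Fin k)) : ℝ :=
  (∑ p : Equiv.Perm (Fin n), (occCount q p : ℝ)) / (n.factorial : ℝ)

/-- The variance of the number of occurrences of `q` in a uniformly random
permutation of length `n`. -/
noncomputable def varOcc (k n : ℕ) (q : Equiv.Perm (Fin k)) : ℝ :=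
  (∑ p : Equiv.Perm (Fin n), ((occCount q p : ℝ) - meanOcc k n q) ^ 2) / (n.factorial : ℝ)

namespace PatCLT
open MeasureTheory ProbabilityTheory

section general
variable {E : Type*} [MeasurableSpace E] (ν : Measure E) [IsProbabilityMeasure ν]

lemma mix_mp {κ : Type*} [Fintype κ] (A : κ → Prop) [DecidablePred A] :
    MeasurePreserving (fun (p : (κ → E) × (κ → E)) (i : κ) => if A i then p.1 i else p.2 i)
      ((Measure.pi fun _ : κ => ν).prod (Measure.pi fun _ : κ => ν))
      (Measure.pi fun _ : κ => ν) := by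
  have hm : Measurable (fun (p : (κ → E) × (κ → E)) (i : κ) => if A i then p.1 i else p.2 i) := by
    refine measurable_pi_lambda _ fun i => ?_
    by_cases hi : A i
    · simp only [hi, if_true]; fun_prop
    · simp only [hi, if_false]; fun_prop
  refine ⟨hm, ?_⟩
  symm
  refine Measure.pi_eq fun s hs => ?_
  rw [Measure.map_apply hm (MeasurableSet.univ_pi hs)]
  have : (fun (p : (κ → E) × (κ → E)) (i : κ) => if A i then p.1 i else p.2 i) ⁻¹'
      (Set.univ.pi s) = (Set.univ.pi fun i => if A i then s i else Set.univ) ×ˢ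
        (Set.univ.pi fun i => if A i then Set.univ else s i) := by
    ext p
    simp only [Set.mem_preimage, Set.mem_pi, Set.mem_univ, true_imp_iff, Set.mem_prod]
    constructor
    · intro h
      refine ⟨fun i => ?_, fun i => ?_⟩ <;> have := h i <;> by_cases hi : A i <;> simp_all
    · rintro ⟨h1, h2⟩ i
      have h1 := h1 i
      have h2 := h2 i
      by_cases hi : A i <;> simp_all
  rw [this, Measure.prod_prod, Measure.pi_pi, Measure.pi_pi, ← Finset.prod_mul_distrib]
  refine Finset.prod_congr rfl fun i _ => ?_
  by_cases hi : A i <;> simp [hi]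

lemma comp_mp {κ κ' : Type*} [Fintype κ] [Fintype κ'] (ι : κ → κ') (hι : Function.Injective ι) :
    MeasurePreserving (fun (z : κ' → E) (a : κ) => z (ι a))
      (Measure.pi fun _ : κ' => ν) (Measure.pi fun _ : κ => ν) := by
  refine ⟨by fun_prop, ?_⟩
  have h0 : iIndepFun (fun (i : κ') (z : κ' → E) => z i) (Measure.pi fun _ : κ' => ν) :=
    iIndepFun_pi (X := fun _ x => x) (fun _ => aemeasurable_id)
  have h1 := h0.precomp hι
  have h2 := (iIndepFun_iff_map_fun_eq_pi_map
    (fun i => (measurable_pi_apply (ι i)).aemeasurable)).1 h1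
  refine Eq.trans h2 ?_
  congr 1
  ext1 a
  exact (measurePreserving_eval (fun _ : κ' => ν) (ι a)).map_eq

/-- degenerate kernels: uncorrelated unless two indices are shared -/
lemma degenerate_cov {k n : ℕ} (r : (Fin k → E) → ℝ) (hr : Measurable r) (C : ℝ)
    (hC : ∀ z, |r z| ≤ C)
    (hdeg : ∀ j w, ∫ z, r (Function.update z j w) ∂(Measure.pi fun _ : Fin k => ν) = 0)
    (ι ι' : Fin k → Fin n) (hι : Function.Injective ι)
    (j : Fin k) (hj : ∀ a, a ≠ j → ∀ b, ι a ≠ ι' b) :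
    ∫ z, r (fun a => z (ι a)) * r (fun a => z (ι' a)) ∂(Measure.pi fun _ : Fin n => ν) = 0 := by
  classical
  let A : Fin n → Prop := fun i => ∃ a, a ≠ j ∧ ι a = i
  have hmix := mix_mp ν A
  have hmeas : Measurable (fun z : Fin n → E => r (fun a => z (ι a)) * r (fun a => z (ι' a))) := by
    fun_prop
  rw [← hmix.map_eq, integral_map hmix.measurable.aemeasurable hmeas.aestronglyMeasurable]
  rw [integral_prod_symm]
  · refine integral_eq_zero_of_ae (ae_of_all _ fun y => ?_)
    simp only [Pi.zero_apply]
    have e1 : ∀ x : Fin n → E, (fun a => if A (ι' a) then x (ι' a) else y (ι' a)) =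
        fun a => y (ι' a) := by
      intro x; ext a
      have : ¬ A (ι' a) := by
        rintro ⟨b, hb, hba⟩
        exact hj b hb a hba
      simp [this]
    have e2 : ∀ x : Fin n → E, (fun a => if A (ι a) then x (ι a) else y (ι a)) =
        Function.update (fun a => x (ι a)) j (y (ι j)) := by
      intro x; ext a
      by_cases ha : a = j
      · subst ha
        have : ¬ A (ι a) := by
          rintro ⟨b, hb, hba⟩
          exact hb (hι hba)
        simp [this]
      · have : A (ι a) := ⟨a, ha, rfl⟩
        simp [this, ha]
    simp only [e1, e2]
    rw [integral_mul_const]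
    have := (comp_mp ν ι hι)
    have h3 := hdeg j (y (ι j))
    rw [← this.map_eq, integral_map this.measurable.aemeasurable] at h3
    · rw [h3, zero_mul]
    · have : Measurable (fun z : Fin k → E => r (Function.update z j (y (ι j)))) :=
        hr.comp (by fun_prop)
      exact this.aestronglyMeasurable
  · refine Integrable.of_bound (C := C * C) ?_ (ae_of_all _ fun p => ?_)
    · exact (hmeas.comp hmix.measurable).aestronglyMeasurable
    · rw [norm_mul]
      exact mul_le_mul (hC _) (hC _) (norm_nonneg _) ((abs_nonneg _).trans (hC (fun a => p.1 (ι a))))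

end general

lemma count_two {k n : ℕ} (a b c d : Fin k) (hcd : c ≠ d) :
    (Finset.univ.filter fun p : (Fin k → Fin n) × (Fin k → Fin n) =>
      p.1 a = p.2 c ∧ p.1 b = p.2 d).card ≤ n ^ (2 * k - 2) := by
  classical
  have hk : 2 ≤ k := by
    have := Fintype.card_le_of_injective (fun b : Bool => if b then c else d)
      (by intro x y; cases x <;> cases y <;> simp [hcd, hcd.symm])
    simpa using this
  have h1 : (Finset.univ : Finset ((Fin k → Fin n) ×
      ({x : Fin k // x ∉ ({c, d} : Finset (Fin k))} → Fin n))).card = n ^ (2 * k - 2) := by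
    have h2 : Fintype.card {x : Fin k // x ∉ ({c, d} : Finset (Fin k))} = k - 2 := by
      rw [Fintype.card_subtype_compl, Fintype.card_coe, Finset.card_pair hcd, Fintype.card_fin]
    rw [Finset.card_univ, Fintype.card_prod, Fintype.card_fun, Fintype.card_fun, h2,
      Fintype.card_fin, Fintype.card_fin, ← pow_add]
    congr 1
    omega
  rw [← h1]
  refine Finset.card_le_card_of_injOn (fun p => (p.1, fun x => p.2 x.1)) (by simp) ?_
  rintro ⟨p1, p2⟩ hp ⟨q1, q2⟩ hq h
  simp only [Finset.coe_filter, Finset.mem_univ, true_and, Set.mem_ofPred_eq] at hp hq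
  simp only [Prod.mk.injEq] at h
  obtain ⟨rfl, h2⟩ := h
  congr 1
  ext1 x
  by_cases hx : x ∈ ({c, d} : Finset (Fin k))
  · simp only [Finset.mem_insert, Finset.mem_singleton] at hx
    rcases hx with rfl | rfl
    · rw [← hp.1, hq.1]
    · rw [← hp.2, hq.2]
  · exact congrFun h2 ⟨x, hx⟩

lemma count_bad {k n : ℕ} :
    (Finset.univ.filter fun p : (Fin k ↪ Fin n) × (Fin k ↪ Fin n) =>
      ¬ ∃ j, ∀ a, a ≠ j → ∀ b, p.1 a ≠ p.2 b).card ≤ 1 + k ^ 4 * n ^ (2 * k - 2) := by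
  classical
  rcases Nat.eq_zero_or_pos k with rfl | hk
  · refine (Finset.card_le_univ _).trans ?_
    simp
  refine le_trans ?_ (Nat.le_add_left _ 1)
  let S : Finset ((Fin k × Fin k) × (Fin k × Fin k)) := Finset.univ.filter fun t => t.2.1 ≠ t.2.2
  let B : (Fin k × Fin k) × (Fin k × Fin k) → Finset ((Fin k → Fin n) × (Fin k → Fin n)) :=
    fun t => Finset.univ.filter fun p => p.1 t.1.1 = p.2 t.2.1 ∧ p.1 t.1.2 = p.2 t.2.2
  calc _ ≤ (S.biUnion B).card := by
        refine Finset.card_le_card_of_injOn (fun p => (⇑p.1, ⇑p.2)) ?_ ?_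
        · rintro ⟨p1, p2⟩ hp
          simp only [Finset.coe_filter, Finset.mem_univ, true_and, Set.mem_ofPred_eq] at hp
          push Not at hp
          obtain ⟨a, -, c, hac⟩ := hp ⟨0, hk⟩
          obtain ⟨b, hb, d, hbd⟩ := hp a
          simp only [Finset.coe_biUnion, Set.mem_iUnion]
          refine ⟨((a, b), (c, d)), ?_, ?_⟩
          · simp only [S, Finset.coe_filter, Finset.mem_univ, true_and, Set.mem_ofPred_eq]
            rintro rfl
            exact hb (p1.injective (hbd.trans hac.symm))
          · simp [B, hac, hbd]
        · rintro ⟨p1, p2⟩ - ⟨q1, q2⟩ - h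
          simpa using h
    _ ≤ ∑ t ∈ S, (B t).card := Finset.card_biUnion_le
    _ ≤ ∑ t ∈ S, n ^ (2 * k - 2) := by
        refine Finset.sum_le_sum fun t ht => ?_
        exact count_two _ _ _ _ (by simpa [S] using ht)
    _ ≤ k ^ 4 * n ^ (2 * k - 2) := by
        rw [Finset.sum_const, smul_eq_mul]
        refine Nat.mul_le_mul_right _ ((Finset.card_le_univ _).trans ?_)
        simp only [Fintype.card_prod, Fintype.card_fin]
        apply le_of_eq; ring

/-- averaging a function of one coordinate over all embeddings -/
lemma sum_emb {k n : ℕ} (hn : 0 < n) (φ : Fin n → ℝ) (j : Fin k) :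
    ∑ ι : Fin k ↪ Fin n, φ (ι j) = ((n.descFactorial k : ℝ) / n) * ∑ i, φ i := by
  have : NeZero n := ⟨hn.ne'⟩
  have h1 : ∀ t : Fin n, ∑ ι : Fin k ↪ Fin n, φ (ι j) = ∑ ι : Fin k ↪ Fin n, φ (ι j + t) := by
    intro t
    symm
    let e : (Fin k ↪ Fin n) ≃ (Fin k ↪ Fin n) :=
      (Equiv.refl _).embeddingCongr (Equiv.addRight t)
    exact Fintype.sum_equiv e _ _ (fun ι => by simp [e, Equiv.embeddingCongr])
  have h2 : (n : ℝ) * ∑ ι : Fin k ↪ Fin n, φ (ι j) =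
      (n.descFactorial k : ℝ) * ∑ i, φ i := by
    calc _ = ∑ t : Fin n, ∑ ι : Fin k ↪ Fin n, φ (ι j) := by simp
      _ = ∑ t : Fin n, ∑ ι : Fin k ↪ Fin n, φ (ι j + t) := Finset.sum_congr rfl fun t _ => h1 t
      _ = ∑ ι : Fin k ↪ Fin n, ∑ t : Fin n, φ (ι j + t) := Finset.sum_comm
      _ = ∑ ι : Fin k ↪ Fin n, ∑ t : Fin n, φ t := by
          refine Finset.sum_congr rfl fun ι _ => ?_
          exact Fintype.sum_equiv (Equiv.addLeft (ι j)) _ _ (fun t => by simp)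
      _ = _ := by simp [Fintype.card_embedding_eq]
  have : (n : ℝ) ≠ 0 := by positivity
  field_simp
  linarith

end PatCLT

namespace PatCLT
open MeasureTheory ProbabilityTheory

section ustat
variable {E : Type*} [MeasurableSpace E] (ν : Measure E) [IsProbabilityMeasure ν]

lemma mp_int {α β : Type*} [MeasurableSpace α] [MeasurableSpace β] {μ : Measure α} {μ' : Measure β}
    {f : α → β} (hp : MeasurePreserving f μ μ') {F : β → ℝ} (hF : Measurable F) :
    ∫ x, F (f x) ∂μ = ∫ y, F y ∂μ' := by
  rw [← hp.map_eq, integral_map hp.measurable.aemeasurable hF.aestronglyMeasurable]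

lemma var_rem {k n : ℕ} (r : (Fin k → E) → ℝ) (hr : Measurable r) (C : ℝ)
    (hC : ∀ z, |r z| ≤ C)
    (hdeg : ∀ j w, ∫ z, r (Function.update z j w) ∂(Measure.pi fun _ : Fin k => ν) = 0) :
    ∫ z, (∑ ι : Fin k ↪ Fin n, r (fun a => z (ι a))) ^ 2 ∂(Measure.pi fun _ : Fin n => ν) ≤
      (1 + k ^ 4 * n ^ (2 * k - 2) : ℝ) * C ^ 2 := by
  classical
  have hb : ∀ (ι ι' : Fin k → Fin n) (z : Fin n → E),
      ‖r (fun a => z (ι a)) * r (fun a => z (ι' a))‖ ≤ C ^ 2 := by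
    intro ι ι' z
    rw [norm_mul, sq]
    exact mul_le_mul (hC _) (hC _) (norm_nonneg _) ((abs_nonneg _).trans (hC (fun a => z (ι a))))
  have h_intg : ∀ ι ι' : Fin k → Fin n, Integrable (fun z : Fin n → E =>
      r (fun a => z (ι a)) * r (fun a => z (ι' a))) (Measure.pi fun _ : Fin n => ν) := by
    intro ι ι'
    refine Integrable.of_bound (C := C ^ 2) ?_ (ae_of_all _ fun z => hb ι ι' z)
    have : Measurable (fun z : Fin n → E => r (fun a => z (ι a)) * r (fun a => z (ι' a))) := by
      fun_prop
    exact this.aestronglyMeasurable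
  have h1 : ∫ z, (∑ ι : Fin k ↪ Fin n, r (fun a => z (ι a))) ^ 2 ∂(Measure.pi fun _ : Fin n => ν)
      = ∑ p : (Fin k ↪ Fin n) × (Fin k ↪ Fin n), ∫ z, r (fun a => z (p.1 a)) *
        r (fun a => z (p.2 a)) ∂(Measure.pi fun _ : Fin n => ν) := by
    rw [← integral_finsetSum _ (fun p _ => h_intg p.1 p.2)]
    refine integral_congr_ae (ae_of_all _ fun z => ?_)
    simp only [sq, Finset.sum_mul_sum, Fintype.sum_prod_type]
  rw [h1]
  calc _ ≤ ∑ p : (Fin k ↪ Fin n) × (Fin k ↪ Fin n),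
        if (¬ ∃ j, ∀ a, a ≠ j → ∀ b, p.1 a ≠ p.2 b) then C ^ 2 else 0 := by
        refine Finset.sum_le_sum fun p _ => ?_
        by_cases hp : ∃ j, ∀ a, a ≠ j → ∀ b, p.1 a ≠ p.2 b
        swap
        · rw [if_pos hp]
          refine (le_abs_self _).trans ?_
          have := norm_integral_le_of_norm_le_const (μ := Measure.pi fun _ : Fin n => ν)
            (ae_of_all _ fun z => hb p.1 p.2 z)
          simpa using this
        · rw [if_neg (not_not.2 hp)]
          obtain ⟨j, hj⟩ := hp
          exact (degenerate_cov ν r hr C hC hdeg p.1 p.2 p.1.injective j hj).le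
    _ ≤ _ := by
        rw [← Finset.sum_filter, Finset.sum_const, nsmul_eq_mul]
        refine mul_le_mul_of_nonneg_right ?_ (sq_nonneg C)
        exact_mod_cast count_bad

/-- mean of the kernel -/
noncomputable def thetaK {k : ℕ} (h : (Fin k → E) → ℝ) : ℝ :=
  ∫ z, h z ∂(Measure.pi fun _ : Fin k => ν)

/-- one-coordinate projections -/
noncomputable def projK {k : ℕ} (h : (Fin k → E) → ℝ) (j : Fin k) (w : E) : ℝ :=
  ∫ z, h (Function.update z j w) ∂(Measure.pi fun _ : Fin k => ν)

/-- the Hajek projection -/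
noncomputable def gK {k : ℕ} (h : (Fin k → E) → ℝ) (w : E) : ℝ :=
  ∑ j, (projK ν h j w - thetaK ν h)

/-- the degenerate remainder -/
noncomputable def remK {k : ℕ} (h : (Fin k → E) → ℝ) (z : Fin k → E) : ℝ :=
  h z - thetaK ν h - ∑ j, (projK ν h j (z j) - thetaK ν h)

variable {k : ℕ} (h : (Fin k → E) → ℝ)

lemma measurable_update_pair (j : Fin k) :
    Measurable (fun p : E × (Fin k → E) => Function.update p.2 j p.1) := by
  refine measurable_pi_lambda _ fun i => ?_
  by_cases hi : i = j
  · subst hi; simp only [Function.update_self]; fun_prop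
  · simp only [Function.update_of_ne hi]; fun_prop

lemma projK_measurable (hm : Measurable h) (j : Fin k) : Measurable (projK ν h j) := by
  have h1 : StronglyMeasurable (Function.uncurry fun (w : E) (z : Fin k → E) =>
      h (Function.update z j w)) :=
    (hm.comp (measurable_update_pair j)).stronglyMeasurable
  exact h1.integral_prod_right.measurable

lemma projK_bound (hb : ∀ z, |h z| ≤ 1) (j : Fin k) (w : E) : |projK ν h j w| ≤ 1 := by
  have := norm_integral_le_of_norm_le_const (μ := Measure.pi fun _ : Fin k => ν)
    (f := fun z => h (Function.update z j w)) (C := 1)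
    (ae_of_all _ fun z => hb (Function.update z j w))
  simpa [projK] using this

lemma thetaK_bound (hb : ∀ z, |h z| ≤ 1) : |thetaK ν h| ≤ 1 := by
  have := norm_integral_le_of_norm_le_const (μ := Measure.pi fun _ : Fin k => ν)
    (f := h) (C := 1) (ae_of_all _ fun z => hb z)
  simpa [thetaK] using this

lemma projK_mean (hm : Measurable h) (hb : ∀ z, |h z| ≤ 1) (j : Fin k) : ∫ w, projK ν h j w ∂ν = thetaK ν h := by
  classical
  have hmix := mix_mp ν (fun i : Fin k => i = j)
  have h0 := measurePreserving_eval (fun _ : Fin k => ν) j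
  have h1 : ∫ w, projK ν h j w ∂ν = ∫ x : Fin k → E, projK ν h j (x j)
      ∂(Measure.pi fun _ : Fin k => ν) := by
    exact (mp_int h0 (projK_measurable ν h hm j)).symm
  rw [h1, thetaK]
  conv_rhs => rw [← hmix.map_eq]
  rw [integral_map hmix.measurable.aemeasurable hm.aestronglyMeasurable, integral_prod]
  · refine integral_congr_ae (ae_of_all _ fun x => ?_)
    simp only [projK]
    refine integral_congr_ae (ae_of_all _ fun y => ?_)
    simp only
    congr 1
    ext i
    by_cases hi : i = j
    · subst hi; simp
    · simp [hi]
  · refine Integrable.of_bound (C := 1) ?_ (ae_of_all _ fun p => hb _)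
    exact (hm.comp hmix.measurable).aestronglyMeasurable

lemma projK_integrable (hm : Measurable h) (hb : ∀ z, |h z| ≤ 1) (j : Fin k) : Integrable (projK ν h j) ν :=
  Integrable.of_bound (C := 1) (projK_measurable ν h hm j).aestronglyMeasurable
    (ae_of_all _ fun w => projK_bound ν h hb j w)

lemma gK_measurable (hm : Measurable h) : Measurable (gK ν h) := by
  unfold gK
  have := fun j => projK_measurable ν h hm j
  fun_prop

lemma gK_bound (hb : ∀ z, |h z| ≤ 1) (w : E) : |gK ν h w| ≤ 2 * k := by
  unfold gK
  calc _ ≤ ∑ j : Fin k, |projK ν h j w - thetaK ν h| := Finset.abs_sum_le_sum_abs _ _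
    _ ≤ ∑ j : Fin k, 2 := by
      refine Finset.sum_le_sum fun j _ => ?_
      have h1 := abs_le.1 (projK_bound ν h hb j w)
      have h2 := abs_le.1 (thetaK_bound ν h hb)
      rw [abs_le]; constructor <;> linarith
    _ = _ := by simp; ring

lemma gK_mean (hm : Measurable h) (hb : ∀ z, |h z| ≤ 1) : ∫ w, gK ν h w ∂ν = 0 := by
  unfold gK
  rw [integral_finsetSum]
  · refine Finset.sum_eq_zero fun j _ => ?_
    rw [integral_sub (projK_integrable ν h hm hb j) (integrable_const _), projK_mean ν h hm hb]
    simp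
  · exact fun j _ => (projK_integrable ν h hm hb j).sub (integrable_const _)

lemma remK_measurable (hm : Measurable h) : Measurable (remK ν h) := by
  unfold remK
  have := fun j => projK_measurable ν h hm j
  fun_prop

lemma remK_bound (hb : ∀ z, |h z| ≤ 1) (z : Fin k → E) : |remK ν h z| ≤ 2 + 2 * k := by
  have h0 : |∑ j, (projK ν h j (z j) - thetaK ν h)| ≤ 2 * k := by
    calc _ ≤ ∑ j : Fin k, |projK ν h j (z j) - thetaK ν h| := Finset.abs_sum_le_sum_abs _ _
    _ ≤ ∑ j : Fin k, 2 := by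
      refine Finset.sum_le_sum fun j _ => ?_
      have h1 := abs_le.1 (projK_bound ν h hb j (z j))
      have h2 := abs_le.1 (thetaK_bound ν h hb)
      rw [abs_le]; constructor <;> linarith
    _ = _ := by simp; ring
  have h1 := abs_le.1 (hb z)
  have h2 := abs_le.1 (thetaK_bound ν h hb)
  have h3 := abs_le.1 h0
  unfold remK
  rw [abs_le]; constructor <;> linarith

lemma remK_deg (hm : Measurable h) (hb : ∀ z, |h z| ≤ 1) (j : Fin k) (w : E) :
    ∫ z, remK ν h (Function.update z j w) ∂(Measure.pi fun _ : Fin k => ν) = 0 := by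
  classical
  have hI : Integrable (fun z : Fin k → E => h (Function.update z j w))
      (Measure.pi fun _ : Fin k => ν) := by
    refine Integrable.of_bound (C := 1) ?_ (ae_of_all _ fun p => hb _)
    have : Measurable (fun z : Fin k → E => h (Function.update z j w)) := hm.comp (by fun_prop)
    exact this.aestronglyMeasurable
  have hJ : ∀ i, Integrable (fun z : Fin k → E => projK ν h i (Function.update z j w i) - thetaK ν h)
      (Measure.pi fun _ : Fin k => ν) := by
    intro i
    refine (Integrable.of_bound (C := 1) ?_
      (ae_of_all _ fun p => projK_bound ν h hb _ _)).sub (integrable_const _)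
    have : Measurable (fun z : Fin k → E => projK ν h i (Function.update z j w i)) :=
      (projK_measurable ν h hm i).comp
        ((measurable_pi_apply i).comp
          (by fun_prop : Measurable fun z : Fin k → E => Function.update z j w))
    exact this.aestronglyMeasurable
  unfold remK
  have hI' : Integrable (fun z : Fin k → E => h (Function.update z j w) - thetaK ν h)
      (Measure.pi fun _ : Fin k => ν) := hI.sub (integrable_const _)
  rw [integral_sub hI' (integrable_finsetSum _ fun i _ => hJ i),
    integral_sub hI (integrable_const _), integral_finsetSum _ (fun i _ => hJ i)]
  have e : ∀ i, ∫ z : Fin k → E, (projK ν h i (Function.update z j w i) - thetaK ν h)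
      ∂(Measure.pi fun _ : Fin k => ν) = if i = j then projK ν h j w - thetaK ν h else 0 := by
    intro i
    split_ifs with hi
    · subst hi; simp
    · have h0 := measurePreserving_eval (fun _ : Fin k => ν) i
      have h1 := (mp_int h0 (projK_measurable ν h hm i)).trans (projK_mean ν h hm hb i)
      simp only [Function.update_of_ne hi]
      rw [integral_sub _ (integrable_const _)]
      · simp only [Function.eval] at h1
        rw [h1]; simp
      · refine Integrable.of_bound (C := 1) ?_ (ae_of_all _ fun p => projK_bound ν h hb _ _)
        exact ((projK_measurable ν h hm i).comp (measurable_pi_apply i)).aestronglyMeasurable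
  simp only [e]
  simp [projK]

/-- the statistic, on `n` points -/
noncomputable def stat (n : ℕ) (z : Fin n → E) : ℝ := ∑ ι : Fin k ↪ Fin n, h (fun a => z (ι a))

lemma stat_measurable (hm : Measurable h) (n : ℕ) : Measurable (stat h n) := by
  unfold stat; fun_prop

lemma stat_decomp {n : ℕ} (hn : 0 < n) (z : Fin n → E) :
    stat h n z - n.descFactorial k * thetaK ν h =
      ((n.descFactorial k : ℝ) / n) * ∑ i, gK ν h (z i) +
        ∑ ι : Fin k ↪ Fin n, remK ν h (fun a => z (ι a)) := by
  have h1 : ∀ j : Fin k, ∑ ι : Fin k ↪ Fin n, (projK ν h j (z (ι j)) - thetaK ν h) =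
      ((n.descFactorial k : ℝ) / n) * ∑ i, (projK ν h j (z i) - thetaK ν h) :=
    fun j => sum_emb hn (fun i => projK ν h j (z i) - thetaK ν h) j
  unfold stat remK gK
  rw [Finset.sum_comm (s := (Finset.univ : Finset (Fin n))), Finset.sum_sub_distrib,
    Finset.sum_comm (s := (Finset.univ : Finset (Fin k ↪ Fin n))),
    Finset.mul_sum, Finset.sum_congr rfl (fun j _ => h1 j), Finset.sum_sub_distrib]
  simp [Fintype.card_embedding_eq]

lemma stat_mean (hm : Measurable h) (hb : ∀ z, |h z| ≤ 1) (n : ℕ) : ∫ z, stat h n z ∂(Measure.pi fun _ : Fin n => ν) =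
    n.descFactorial k * thetaK ν h := by
  unfold stat
  have hmeas : ∀ ι : Fin k ↪ Fin n, Measurable (fun z : Fin n → E => h (fun a => z (ι a))) := by
    intro ι; fun_prop
  rw [integral_finsetSum]
  · have : ∀ ι : Fin k ↪ Fin n, ∫ z, h (fun a => z (ι a)) ∂(Measure.pi fun _ : Fin n => ν) =
        thetaK ν h := by
      intro ι
      have hp := comp_mp ν ι ι.injective
      exact mp_int hp hm
    simp [this, Fintype.card_embedding_eq]
  · intro ι _
    exact Integrable.of_bound (C := 1) (hmeas ι).aestronglyMeasurable (ae_of_all _ fun p => hb _)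

end ustat
end PatCLT

namespace PatCLT
open MeasureTheory ProbabilityTheory

lemma l2_normalize {Ω : Type*} [MeasurableSpace Ω] {P : Measure Ω}
    {D u : Ω → ℝ} (hD : MemLp D 2 P) (hu : MemLp u 2 P) (hu1 : ∫ ω, u ω ^ 2 ∂P = 1)
    {ε : ℝ} (hε : ∫ ω, (D ω - u ω) ^ 2 ∂P ≤ ε) (hε' : ε ≤ 1 / 4) :
    ∫ ω, (D ω / √(∫ ω, D ω ^ 2 ∂P) - u ω) ^ 2 ∂P ≤ 2 * ε := by
  have iD := hD.integrable_sq
  have iu := hu.integrable_sq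
  have iDu : Integrable (fun ω => D ω * u ω) P := hD.integrable_mul hu
  set m := ∫ ω, D ω ^ 2 ∂P with hm
  set c := ∫ ω, D ω * u ω ∂P with hc
  have e1 : ∀ a : ℝ, ∫ ω, (a * D ω - u ω) ^ 2 ∂P = a ^ 2 * m - 2 * a * c + 1 := by
    intro a
    have : ∀ ω, (a * D ω - u ω) ^ 2 = a ^ 2 * D ω ^ 2 - 2 * a * (D ω * u ω) + u ω ^ 2 := by
      intro ω; ring
    simp only [this]
    have i1 : Integrable (fun ω => a ^ 2 * D ω ^ 2 - 2 * a * (D ω * u ω)) P :=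
      (iD.const_mul _).sub (iDu.const_mul _)
    rw [integral_add i1 iu,
      integral_sub (iD.const_mul _) (iDu.const_mul _), integral_const_mul, integral_const_mul, hu1]
  have hε0 : 0 ≤ ε := le_trans (integral_nonneg fun ω => sq_nonneg _) hε
  have h1 := e1 1
  simp only [one_mul] at h1
  have e2 := e1 2
  have h2 : 0 ≤ ∫ ω, (2 * D ω - u ω) ^ 2 ∂P := integral_nonneg fun ω => sq_nonneg _
  rw [e2] at h2
  rw [h1] at hε
  -- 4 m - 4 c + 1 ≥ 0 and m - 2 c + 1 ≤ ε
  have hm4 : 1 / 4 ≤ m := by linarith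
  set s := √m with hs
  have hs2 : s ^ 2 = m := Real.sq_sqrt (by linarith)
  have hs1 : 1 / 2 ≤ s := Real.le_sqrt_of_sq_le (by linarith)
  have h3 := e1 s⁻¹
  have : ∀ ω, D ω / s - u ω = s⁻¹ * D ω - u ω := fun ω => by ring
  simp only [this]
  rw [h3, ← hs2]
  have hs0 : s ≠ 0 := by linarith
  have : s⁻¹ ^ 2 * s ^ 2 - 2 * s⁻¹ * c + 1 = (2 * s - 2 * c) / s := by field_simp; ring
  rw [this, div_le_iff₀ (by linarith)]
  nlinarith [sq_nonneg (s - 1), mul_le_mul_of_nonneg_left hs1 hε0]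

lemma tendstoInMeasure_of_sq {Ω : Type*} [MeasurableSpace Ω] {P : Measure Ω}
    [IsProbabilityMeasure P] {f : ℕ → Ω → ℝ} (hf : ∀ n, MemLp (f n) 2 P)
    (h : Tendsto (fun n => ∫ ω, f n ω ^ 2 ∂P) atTop (nhds 0)) :
    TendstoInMeasure P f atTop 0 := by
  rw [tendstoInMeasure_iff_measureReal_norm]
  intro ε hε
  simp only [Pi.zero_apply, sub_zero]
  have h2 : Tendsto (fun n => (∫ ω, f n ω ^ 2 ∂P) / ε ^ 2) atTop (nhds 0) := by
    simpa using h.div_const (ε ^ 2)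
  refine squeeze_zero (fun n => measureReal_nonneg) (fun n => ?_) h2
  have := mul_meas_ge_le_integral_of_nonneg (μ := P) (f := fun ω => f n ω ^ 2)
    (ae_of_all _ fun ω => sq_nonneg _) (hf n).integrable_sq (ε ^ 2)
  rw [le_div_iff₀ (by positivity), mul_comm]
  refine le_trans (mul_le_mul_of_nonneg_left (measureReal_mono ?_) (by positivity)) this
  intro ω hω
  simp only [Set.mem_ofPred_eq, Real.norm_eq_abs] at hω ⊢
  rw [← sq_abs (f n ω)]
  exact pow_le_pow_left₀ hε.le hω 2

section main
variable {E : Type*} [MeasurableSpace E] (ν : Measure E) [IsProbabilityMeasure ν]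

lemma restr_mp (n : ℕ) : MeasurePreserving (fun (ω : ℕ → E) (i : Fin n) => ω i)
    (Measure.infinitePi fun _ : ℕ => ν) (Measure.pi fun _ : Fin n => ν) := by
  refine ⟨by fun_prop, ?_⟩
  have h0 : iIndepFun (fun (i : ℕ) (z : ℕ → E) => z i) (Measure.infinitePi fun _ : ℕ => ν) :=
    iIndepFun_infinitePi (X := fun _ x => x) (fun _ => measurable_id)
  have h1 := h0.precomp (g := fun i : Fin n => (i : ℕ)) Fin.val_injective
  have h2 := (iIndepFun_iff_map_fun_eq_pi_map
    (fun i : Fin n => (measurable_pi_apply (i : ℕ)).aemeasurable)).1 h1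
  refine Eq.trans h2 ?_
  congr 1
  ext1 a
  exact Measure.infinitePi_map_eval (fun _ : ℕ => ν) a

variable {k : ℕ} (h : (Fin k → E) → ℝ)

lemma memLp_bdd {Ω : Type*} [MeasurableSpace Ω] {P : Measure Ω} [IsProbabilityMeasure P]
    {f : Ω → ℝ} (hf : Measurable f) (C : ℝ) (hC : ∀ ω, |f ω| ≤ C) : MemLp f 2 P :=
  MemLp.of_bound hf.aestronglyMeasurable C (ae_of_all _ hC)

lemma stat_bound (hb : ∀ z, |h z| ≤ 1) (n : ℕ) (z : Fin n → E) : |stat h n z| ≤ n.descFactorial k := by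
  unfold stat
  calc _ ≤ ∑ ι : Fin k ↪ Fin n, |h (fun a => z (ι a))| := Finset.abs_sum_le_sum_abs _ _
    _ ≤ ∑ ι : Fin k ↪ Fin n, (1 : ℝ) := Finset.sum_le_sum fun ι _ => hb _
    _ = _ := by simp [Fintype.card_embedding_eq]

lemma ratio_bound {n : ℕ} (hn : 2 * k ≤ n) (hn0 : 0 < n) (hk : 1 ≤ k) (v : ℝ) (hv : 0 < v) :
    ((1 + k ^ 4 * n ^ (2 * k - 2) : ℝ) * (2 + 2 * k) ^ 2) /
      ((n.descFactorial k : ℝ) / n * √n * √v) ^ 2 ≤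
    ((1 + k ^ 4) * (2 + 2 * k) ^ 2 * 4 ^ k / v) / n := by
  have hN : ((n : ℝ) / 2) ^ k ≤ n.descFactorial k := by
    have h1 : ((n + 1 - k : ℕ) : ℝ) ^ k ≤ n.descFactorial k := by
      exact_mod_cast Nat.pow_sub_le_descFactorial n k
    refine le_trans (pow_le_pow_left₀ (by positivity) ?_ k) h1
    have h2 : n ≤ 2 * (n + 1 - k) := by omega
    have h3 : (n : ℝ) ≤ 2 * ((n + 1 - k : ℕ) : ℝ) := by exact_mod_cast h2
    linarith
  have hn1 : (1 : ℝ) ≤ n := by exact_mod_cast hn0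
  have hnpos : (0 : ℝ) < n := by linarith
  have e1 : ((n.descFactorial k : ℝ) / n * √n * √v) ^ 2 = (n.descFactorial k : ℝ) ^ 2 * v / n := by
    rw [mul_pow, mul_pow, Real.sq_sqrt hnpos.le, Real.sq_sqrt hv.le]
    field_simp
  have e2 : ((n : ℝ) ^ 2) ^ k / 4 ^ k * v / n ≤ (n.descFactorial k : ℝ) ^ 2 * v / n := by
    have := pow_le_pow_left₀ (by positivity) hN 2
    rw [← pow_mul, mul_comm k 2, pow_mul, div_pow, div_pow] at this
    norm_num at this
    gcongr
  rw [e1]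
  have e3 : (1 + k ^ 4 * n ^ (2 * k - 2) : ℝ) ≤ (1 + k ^ 4) * n ^ (2 * k - 2) := by
    have : (1 : ℝ) ≤ n ^ (2 * k - 2) := one_le_pow₀ hn1
    linarith
  have e4 : ((n : ℝ) ^ 2) ^ k = n ^ (2 * k - 2) * n ^ 2 := by
    rw [← pow_mul, ← pow_add]; congr 1; omega
  calc _ ≤ ((1 + k ^ 4) * n ^ (2 * k - 2) * (2 + 2 * k : ℝ) ^ 2) /
        (((n : ℝ) ^ 2) ^ k / 4 ^ k * v / n) := by gcongr
    _ = _ := by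
      rw [e4]
      have : (n : ℝ) ^ (2 * k - 2) ≠ 0 := by positivity
      field_simp

theorem ustat_clt (hm : Measurable h) (hb : ∀ z, |h z| ≤ 1) (hk : 1 ≤ k) (hv : 0 < ∫ w, gK ν h w ^ 2 ∂ν) :
    TendstoInDistribution (fun (n : ℕ) (ω : ℕ → E) =>
      (stat h n (fun i => ω i) - n.descFactorial k * thetaK ν h) /
        √(∫ z, (stat h n z - n.descFactorial k * thetaK ν h) ^ 2 ∂(Measure.pi fun _ : Fin n => ν)))
      atTop (id : ℝ → ℝ) (fun _ => Measure.infinitePi fun _ : ℕ => ν) (gaussianReal 0 1) := by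
  set P := Measure.infinitePi fun _ : ℕ => ν with hP
  set v := ∫ w, gK ν h w ^ 2 ∂ν with hvdef
  have hg := gK_measurable ν h hm
  have hsv : √v ≠ 0 := (Real.sqrt_pos.2 hv).ne'
  let X : ℕ → (ℕ → E) → ℝ := fun i ω => gK ν h (ω i) / √v
  have hXm : ∀ i, Measurable (X i) := fun i => by
    simp only [X]; fun_prop
  have hXi : iIndepFun X P :=
    iIndepFun_infinitePi (X := fun _ x => gK ν h x / √v) (fun _ => by fun_prop)
  have hev : ∀ i : ℕ, MeasurePreserving (fun ω : ℕ → E => ω i) P ν := fun i =>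
    ⟨by fun_prop, Measure.infinitePi_map_eval (fun _ : ℕ => ν) i⟩
  have hXid : ∀ i, IdentDistrib (X i) (X 0) P P := by
    intro i
    refine ⟨(hXm i).aemeasurable, (hXm 0).aemeasurable, ?_⟩
    have : ∀ i, P.map (X i) = ν.map (fun w => gK ν h w / √v) := by
      intro i
      have e := Measure.map_map (μ := P) (g := fun w => gK ν h w / √v)
        (f := fun ω : ℕ → E => ω i) (by fun_prop) (by fun_prop)
      rw [(hev i).map_eq] at e
      exact e.symm
    rw [this, this]
  have hX0 : ∀ i, ∫ ω, X i ω ∂P = 0 := by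
    intro i
    have := mp_int (hev i) (F := fun w => gK ν h w / √v) (by fun_prop)
    simp only [X]
    rw [this, integral_div, gK_mean ν h hm hb, zero_div]
  have hX1 : ∀ i, ∫ ω, X i ω ^ 2 ∂P = 1 := by
    intro i
    have := mp_int (hev i) (F := fun w => (gK ν h w / √v) ^ 2) (by fun_prop)
    simp only [X]
    rw [this]
    simp only [div_pow]
    rw [integral_div, Real.sq_sqrt hv.le, div_self hv.ne']
  have hXL : ∀ i, MemLp (X i) 2 P := fun i => memLp_bdd (hXm i) (2 * k / √v) fun ω => by
    simp only [X]
    rw [abs_div, abs_of_nonneg (Real.sqrt_nonneg v)]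
    exact div_le_div_of_nonneg_right (gK_bound ν h hb _) (Real.sqrt_nonneg v)
  have hclt := tendstoInDistribution_inv_sqrt_mul_sum (P := P) (X := X) (Y := (id : ℝ → ℝ))
    (P' := gaussianReal 0 1) HasLaw.id (hX0 0) (hX1 0) hXi hXid
  set U : ℕ → (ℕ → E) → ℝ := fun n ω => (√n)⁻¹ * ∑ i ∈ Finset.range n, X i ω with hU
  have hUm : ∀ n, Measurable (U n) := fun n => by simp only [hU]; fun_prop
  have hUL : ∀ n, MemLp (U n) 2 P := fun n => by
    simp only [hU]
    exact (memLp_finsetSum _ fun i _ => hXL i).const_mul _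
  have hU1 : ∀ n, 0 < n → ∫ ω, U n ω ^ 2 ∂P = 1 := by
    intro n hn
    have h1 : Var[∑ i ∈ Finset.range n, X i; P] = n := by
      rw [IndepFun.variance_sum (fun i _ => hXL i)
        (fun i _ j _ hij => hXi.indepFun hij)]
      have : ∀ i, Var[X i; P] = 1 := fun i => by
        rw [variance_of_integral_eq_zero (hXm i).aemeasurable (hX0 i)]
        exact hX1 i
      simp [this]
    rw [variance_of_integral_eq_zero (by fun_prop)] at h1
    · simp only [hU, mul_pow]
      rw [integral_const_mul]
      simp only [Finset.sum_apply] at h1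
      rw [h1]
      have : (0 : ℝ) < n := by exact_mod_cast hn
      rw [inv_pow, Real.sq_sqrt this.le, inv_mul_cancel₀ this.ne']
    · simp only [Finset.sum_apply]
      rw [integral_finsetSum _ (fun i _ => (hXL i).integrable (by simp))]
      simp [hX0]
  let D : ℕ → (ℕ → E) → ℝ := fun n ω =>
    stat h n (fun i => ω i) - n.descFactorial k * thetaK ν h
  have hst := fun n => stat_measurable h hm n
  have hDm : ∀ n, Measurable (D n) := fun n => by
    simp only [D]
    have := (hst n).comp (restr_mp ν n).measurable
    exact this.sub_const _
  have hDL : ∀ n, MemLp (D n) 2 P := fun n =>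
    memLp_bdd (hDm n) (n.descFactorial k + |n.descFactorial k * thetaK ν h|) fun ω =>
      (abs_sub _ _).trans (add_le_add (stat_bound h hb n _) le_rfl)
  have hDV : ∀ n, ∫ z, (stat h n z - n.descFactorial k * thetaK ν h) ^ 2
      ∂(Measure.pi fun _ : Fin n => ν) = ∫ ω, D n ω ^ 2 ∂P := fun n =>
    (mp_int (restr_mp ν n) (((hst n).sub_const _).pow_const 2)).symm
  simp only [hDV]
  refine tendstoInDistribution_of_tendstoInMeasure_sub _ _ hclt ?_
    (fun n => ((hDm n).div_const _).aemeasurable)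
  refine tendstoInMeasure_of_sq (fun n => ?_) ?_
  · have : MemLp (fun ω => (√(∫ ω, D n ω ^ 2 ∂P))⁻¹ * D n ω) 2 P := (hDL n).const_mul _
    refine (MemLp.sub this (hUL n)).ae_eq (ae_of_all _ fun ω => ?_)
    simp only [Pi.sub_apply, D]
    rw [div_eq_inv_mul]
  set K : ℝ := (1 + k ^ 4) * (2 + 2 * k) ^ 2 * 4 ^ k / v with hK
  have hKlim : Tendsto (fun n : ℕ => K / n) atTop (nhds 0) := tendsto_const_div_atTop_nhds_zero_nat K
  have hev2 : ∀ᶠ n : ℕ in atTop,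
      ∫ ω, (D n ω / √(∫ ω, D n ω ^ 2 ∂P) - U n ω) ^ 2 ∂P ≤ 2 * (K / n) := by
    filter_upwards [eventually_ge_atTop (2 * k), eventually_gt_atTop 0,
      hKlim.eventually_le_const (show (0 : ℝ) < 1 / 4 by norm_num)] with n hn hn0 hKn
    have hnpos : (0 : ℝ) < n := by exact_mod_cast hn0
    have hNpos : (0 : ℝ) < n.descFactorial k := by
      exact_mod_cast Nat.descFactorial_pos.2 (by omega)
    set b : ℝ := (n.descFactorial k : ℝ) / n * √n * √v with hbdef
    have hbpos : 0 < b := by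
      have := Real.sqrt_pos.2 hv
      have := Real.sqrt_pos.2 hnpos
      positivity
    have hD' : ∀ ω, D n ω / √(∫ ω, D n ω ^ 2 ∂P) =
        (D n ω / b) / √(∫ ω, (D n ω / b) ^ 2 ∂P) := by
      intro ω
      simp only [div_pow]
      rw [integral_div, Real.sqrt_div' _ (by positivity), Real.sqrt_sq hbpos.le]
      field_simp
    simp only [hD']
    have hDLb : MemLp (fun ω => D n ω / b) 2 P := by
      have : MemLp (fun ω => b⁻¹ * D n ω) 2 P := (hDL n).const_mul _
      simpa only [div_eq_inv_mul] using this
    refine l2_normalize hDLb (hUL n) (hU1 n hn0) ?_ hKn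
    have hR : ∀ ω, D n ω / b - U n ω =
        (∑ ι : Fin k ↪ Fin n, remK ν h (fun a => ω (ι a))) / b := by
      intro ω
      have h1 := stat_decomp ν h hn0 (fun i => ω i)
      have h2 : b * U n ω = ((n.descFactorial k : ℝ) / n) * ∑ i : Fin n, gK ν h (ω i) := by
        simp only [hU, X, ← Finset.sum_div, hbdef]
        rw [Finset.sum_range (fun i => gK ν h (ω i))]
        have := (Real.sqrt_pos.2 hnpos).ne'
        field_simp
      rw [eq_div_iff hbpos.ne', sub_mul, div_mul_cancel₀ _ hbpos.ne', mul_comm (U n ω), h2]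
      simp only [D]
      rw [h1]; ring
    simp only [hR, div_pow]
    rw [integral_div]
    refine le_trans ?_ (ratio_bound hn hn0 hk v hv)
    refine div_le_div_of_nonneg_right ?_ (by positivity)
    have hrm := remK_measurable ν h hm
    have hmR : Measurable (fun z : Fin n → E =>
      (∑ ι : Fin k ↪ Fin n, remK ν h (fun a => z (ι a))) ^ 2) := by fun_prop
    refine le_trans (le_of_eq (mp_int (restr_mp ν n) hmR)) ?_
    exact var_rem ν (remK ν h) hrm _ (remK_bound ν h hb) (remK_deg ν h hm hb)
  refine squeeze_zero' (Eventually.of_forall fun n => integral_nonneg fun ω => sq_nonneg _) hev2 ?_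
  simpa using hKlim.const_mul 2

end main
end PatCLT

namespace PatCLT
open MeasureTheory ProbabilityTheory
open scoped unitInterval

/-- law of a uniform point in the unit square -/
noncomputable abbrev nu : Measure (I × I) := (volume : Measure I).prod (volume : Measure I)

/-- the points form the pattern `q` -/
def IsPat {k : ℕ} (q : Equiv.Perm (Fin k)) (z : Fin k → I × I) : Prop :=
  (∀ a b : Fin k, a < b → (z a).1 < (z b).1) ∧
    (∀ j r : Fin k, q j < q r ↔ (z j).2 < (z r).2)

open Classical in
/-- the pattern kernel -/
noncomputable def patK {k : ℕ} (q : Equiv.Perm (Fin k)) (z : Fin k → I × I) : ℝ :=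
  if IsPat q z then 1 else 0

lemma patK_measurable {k : ℕ} (q : Equiv.Perm (Fin k)) : Measurable (patK q) := by
  classical
  have hS : MeasurableSet {z : Fin k → I × I | IsPat q z} := by
    have h1 : ∀ a b : Fin k, MeasurableSet {z : Fin k → I × I | (z a).1 < (z b).1} := fun a b =>
      measurableSet_lt (by fun_prop) (by fun_prop)
    have h2 : ∀ a b : Fin k, MeasurableSet {z : Fin k → I × I | (z a).2 < (z b).2} := fun a b =>
      measurableSet_lt (by fun_prop) (by fun_prop)
    unfold IsPat
    refine measurableSet_setOfPred.2 (Measurable.and ?_ ?_)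
    · refine Measurable.forall fun a => Measurable.forall fun b => ?_
      exact Measurable.imp measurable_const (measurableSet_setOfPred.1 (h1 a b))
    · refine Measurable.forall fun a => Measurable.forall fun b => ?_
      exact Measurable.iff measurable_const (measurableSet_setOfPred.1 (h2 a b))
  unfold patK
  exact Measurable.ite hS measurable_const measurable_const

lemma patK_bound {k : ℕ} (q : Equiv.Perm (Fin k)) (z : Fin k → I × I) : |patK q z| ≤ 1 := by
  unfold patK
  split_ifs <;> simp

lemma exists_rank {n : ℕ} (x : Fin n → I) (hx : Function.Injective x) :
    ∃ ρ : Equiv.Perm (Fin n), ∀ i j, x i < x j ↔ ρ i < ρ j := by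
  have h1 : StrictMono (x ∘ Tuple.sort x) :=
    (Tuple.monotone_sort x).strictMono_of_injective (hx.comp (Tuple.sort x).injective)
  refine ⟨(Tuple.sort x).symm, fun i j => ?_⟩
  rw [← h1.lt_iff_lt]
  simp

lemma stat_eq_occ {k n : ℕ} (q : Equiv.Perm (Fin k)) (x y : Fin n → I)
    (ρ τ π : Equiv.Perm (Fin n)) (hρ : ∀ i j, x i < x j ↔ ρ i < ρ j)
    (hτ : ∀ i j, y i < y j ↔ τ i < τ j) :
    stat (patK q) n (fun i => (x i, y (π i))) = occCount q (τ * π * ρ⁻¹) := by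
  classical
  unfold stat patK occCount
  rw [Finset.sum_boole]
  norm_cast
  refine Finset.card_nbij (fun ι => ρ ∘ ι) ?_ ?_ ?_
  · intro ι hι
    simp only [Finset.coe_filter, Finset.mem_univ, true_and, Set.mem_ofPred_eq, IsPat, hρ, hτ] at hι ⊢
    simpa using hι
  · intro ι _ ι' _ he
    ext a
    have := congrFun he a
    simpa [Fin.ext_iff] using this
  · intro f hf
    simp only [Finset.coe_filter, Finset.mem_univ, true_and, Set.mem_ofPred_eq] at hf
    have hinj : Function.Injective f := StrictMono.injective (fun a b => hf.1 a b)
    refine ⟨⟨fun a => ρ.symm (f a), ρ.symm.injective.comp hinj⟩, ?_, ?_⟩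
    · simp only [Finset.coe_filter, Finset.mem_univ, true_and, Set.mem_ofPred_eq, IsPat, hρ, hτ]
      simpa [Equiv.Perm.inv_def] using hf
    · ext a; simp

lemma ae_injective (n : ℕ) :
    ∀ᵐ x ∂(Measure.pi fun _ : Fin n => (volume : Measure I)), Function.Injective x := by
  have h1 : ∀ i j : Fin n, i ≠ j →
      ∀ᵐ x ∂(Measure.pi fun _ : Fin n => (volume : Measure I)), x i ≠ x j := by
    intro i j hij
    have hinj : Function.Injective (fun b : Bool => if b then i else j) := by
      intro a b; cases a <;> cases b <;> simp [hij, hij.symm]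
    have hind : iIndepFun (fun (i : Fin n) (z : Fin n → I) => z i)
        (Measure.pi fun _ : Fin n => (volume : Measure I)) :=
      iIndepFun_pi (X := fun _ x => x) (fun _ => aemeasurable_id)
    have h2 := (indepFun_iff_map_prod_eq_prod_map_map (measurable_pi_apply i).aemeasurable
      (measurable_pi_apply j).aemeasurable).1
      (hind.indepFun hij)
    rw [(measurePreserving_eval (fun _ : Fin n => (volume : Measure I)) i).map_eq,
      (measurePreserving_eval (fun _ : Fin n => (volume : Measure I)) j).map_eq] at h2
    have h3 : ∀ᵐ p ∂((volume : Measure I).prod (volume : Measure I)), p.1 ≠ p.2 := by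
      rw [Measure.ae_prod_iff_ae_ae]
      · refine ae_of_all _ fun a => ?_
        simp only
        rw [ae_iff]
        simp
      · exact (measurableSet_eq_fun measurable_fst measurable_snd).compl
    rw [← h2] at h3
    exact ae_of_ae_map (f := fun z : Fin n → I => (z i, z j)) (p := fun p : I × I => p.1 ≠ p.2)
      ((measurable_pi_apply i).prodMk (measurable_pi_apply j)).aemeasurable h3
  have h2 : ∀ᵐ x ∂(Measure.pi fun _ : Fin n => (volume : Measure I)),
      ∀ i j : Fin n, i ≠ j → x i ≠ x j := by
    rw [ae_all_iff]; intro i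
    rw [ae_all_iff]; intro j
    by_cases hij : i = j
    · simp [hij]
    · filter_upwards [h1 i j hij] with x hx _ using hx
  filter_upwards [h2] with x hx i j hij
  by_contra hne
  exact hx i j hne hij

lemma pair_mp {n : ℕ} (π : Equiv.Perm (Fin n)) :
    MeasurePreserving (fun (p : (Fin n → I) × (Fin n → I)) (i : Fin n) => (p.1 i, p.2 (π i)))
      ((Measure.pi fun _ : Fin n => (volume : Measure I)).prod
        (Measure.pi fun _ : Fin n => (volume : Measure I)))
      (Measure.pi fun _ : Fin n => nu) := by
  have h1 := (measurePreserving_arrowProdEquivProdArrow I I (Fin n)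
    (fun _ => (volume : Measure I)) (fun _ => (volume : Measure I))).symm
  have h2 := (MeasurePreserving.id (Measure.pi fun _ : Fin n => (volume : Measure I))).prod
    (comp_mp (volume : Measure I) π π.injective)
  exact h1.comp h2

lemma expect_eq {k n : ℕ} (q : Equiv.Perm (Fin k)) (F : ℝ → ℝ) (hF : Measurable F)
    (C : ℝ) (hC : ∀ z, |F (stat (patK q) n z)| ≤ C) :
    ∫ z, F (stat (patK q) n z) ∂(Measure.pi fun _ : Fin n => nu) =
      (∑ p : Equiv.Perm (Fin n), F (occCount q p)) / n.factorial := by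
  have hm : Measurable (fun z => F (stat (patK q) n z)) :=
    hF.comp (stat_measurable _ (patK_measurable q) n)
  set M := (Measure.pi fun _ : Fin n => (volume : Measure I)).prod
        (Measure.pi fun _ : Fin n => (volume : Measure I)) with hM
  have h1 : ∀ π : Equiv.Perm (Fin n),
      ∫ p, F (stat (patK q) n (fun i => (p.1 i, p.2 (π i)))) ∂M =
      ∫ z, F (stat (patK q) n z) ∂(Measure.pi fun _ : Fin n => nu) := fun π =>
    mp_int (pair_mp π) hm
  have h2 : ∑ π : Equiv.Perm (Fin n),
      ∫ p, F (stat (patK q) n (fun i => (p.1 i, p.2 (π i)))) ∂M =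
      ∑ p : Equiv.Perm (Fin n), F (occCount q p) := by
    rw [← integral_finsetSum]
    · have : ∀ᵐ p ∂M, ∑ π : Equiv.Perm (Fin n),
          F (stat (patK q) n (fun i => (p.1 i, p.2 (π i)))) =
          ∑ p : Equiv.Perm (Fin n), F (occCount q p) := by
        have a1 := Measure.quasiMeasurePreserving_fst (μ := Measure.pi fun _ : Fin n =>
          (volume : Measure I)) (ν := Measure.pi fun _ : Fin n => (volume : Measure I))
            |>.ae (ae_injective n)
        have a2 := Measure.quasiMeasurePreserving_snd (μ := Measure.pi fun _ : Fin n =>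
          (volume : Measure I)) (ν := Measure.pi fun _ : Fin n => (volume : Measure I))
            |>.ae (ae_injective n)
        filter_upwards [a1, a2] with p hp1 hp2
        obtain ⟨ρ, hρ⟩ := exists_rank p.1 hp1
        obtain ⟨τ, hτ⟩ := exists_rank p.2 hp2
        simp only [stat_eq_occ q p.1 p.2 ρ τ _ hρ hτ]
        exact Fintype.sum_equiv ((Equiv.mulLeft τ).trans (Equiv.mulRight ρ⁻¹)) _ _
          (fun π => by simp)
      rw [integral_congr_ae this]
      simp
    · intro π _
      refine Integrable.of_bound (C := C) ?_ (ae_of_all _ fun p => hC _)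
      exact (hm.comp (pair_mp π).measurable).aestronglyMeasurable
  simp only [h1] at h2
  rw [Finset.sum_const, Finset.card_univ, Fintype.card_perm, Fintype.card_fin, nsmul_eq_mul] at h2
  have : (n.factorial : ℝ) ≠ 0 := by positivity
  rw [← h2]
  field_simp

lemma mean_eq {k : ℕ} (n : ℕ) (q : Equiv.Perm (Fin k)) :
    meanOcc k n q = n.descFactorial k * thetaK nu (patK q) := by
  rw [← stat_mean nu (patK q) (patK_measurable q) (patK_bound q) n]
  exact (expect_eq q (fun x => x) measurable_id _ (stat_bound _ (patK_bound q) n)).symm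

lemma var_eq {k : ℕ} (n : ℕ) (q : Equiv.Perm (Fin k)) :
    varOcc k n q = ∫ z, (stat (patK q) n z - n.descFactorial k * thetaK nu (patK q)) ^ 2
      ∂(Measure.pi fun _ : Fin n => nu) := by
  rw [← mean_eq]
  refine (expect_eq q (fun x => (x - meanOcc k n q) ^ 2) (by fun_prop)
    ((n.descFactorial k + |meanOcc k n q|) ^ 2) (fun z => ?_)).symm
  simp only [abs_pow]
  refine pow_le_pow_left₀ (abs_nonneg _) ?_ 2
  exact (abs_sub _ _).trans (add_le_add (stat_bound _ (patK_bound q) n z) le_rfl)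

lemma theta_pos {k : ℕ} (q : Equiv.Perm (Fin k)) : 0 < thetaK nu (patK q) := by
  have h1 := mean_eq k q
  have h2 : 0 < meanOcc k k q := by
    unfold meanOcc
    refine div_pos (Finset.sum_pos' (fun p _ => by positivity) ⟨q, Finset.mem_univ _, ?_⟩)
      (by positivity)
    rw [Nat.cast_pos]
    exact Finset.card_pos.2 ⟨fun a => a, by simp⟩
  rw [h1] at h2
  exact pos_of_mul_pos_right h2 (by positivity)

lemma proj_le {k : ℕ} (q : Equiv.Perm (Fin k)) (j b : Fin k) (w : I × I) (S : Set (I × I))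
    (hS : MeasurableSet S) (hbj : ∀ z : Fin k → I × I, IsPat q (Function.update z j w) → z b ∈ S) :
    projK nu (patK q) j w ≤ nu.real S := by
  classical
  have h1 : ∫ z : Fin k → I × I, S.indicator (fun _ => (1 : ℝ)) (z b)
      ∂(Measure.pi fun _ : Fin k => nu) = nu.real S := by
    have := mp_int (measurePreserving_eval (fun _ : Fin k => nu) b)
      (F := S.indicator (fun _ => (1 : ℝ))) (measurable_const.indicator hS)
    refine Eq.trans this ?_
    simp [integral_indicator hS]
  rw [← h1, projK]
  refine integral_mono ?_ ?_ (fun z => ?_)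
  · refine Integrable.of_bound (C := 1) ?_ (ae_of_all _ fun z => patK_bound q _)
    have : Measurable (fun z : Fin k → I × I => patK q (Function.update z j w)) :=
      (patK_measurable q).comp (by fun_prop)
    exact this.aestronglyMeasurable
  · refine Integrable.of_bound (C := 1) ?_ (ae_of_all _ fun z => ?_)
    · have : Measurable (fun z : Fin k → I × I => S.indicator (fun _ => (1 : ℝ)) (z b)) :=
        (measurable_const.indicator hS).comp (measurable_pi_apply b)
      exact this.aestronglyMeasurable
    · simp only [Set.indicator]
      split_ifs <;> simp
  · simp only [patK, Set.indicator]
    split_ifs with h2 h3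
    · exact le_rfl
    · exact absurd (hbj z h2) h3
    · exact zero_le_one
    · exact le_rfl

lemma nu_real_prod (S T : Set I) : nu.real (S ×ˢ T) = volume.real S * volume.real T :=
  measureReal_prod_prod S T

lemma nondeg {k : ℕ} (hk : 2 ≤ k) (q : Equiv.Perm (Fin k)) :
    0 < ∫ w, gK nu (patK q) w ^ 2 ∂nu := by
  have hgm := gK_measurable nu (patK q) (patK_measurable q)
  have hgb := gK_bound nu (patK q) (patK_bound q)
  have hθ := theta_pos q
  have hθ1 : thetaK nu (patK q) ≤ 1 := (abs_le.1 (thetaK_bound nu (patK q) (patK_bound q))).2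
  set θ := thetaK nu (patK q) with hθdef
  have h_intg : Integrable (fun w => gK nu (patK q) w ^ 2) nu :=
    (memLp_bdd hgm _ hgb).integrable_sq
  refine lt_of_le_of_ne (integral_nonneg fun w => sq_nonneg _) fun h0 => ?_
  have h1 := (integral_eq_zero_iff_of_nonneg (fun w => sq_nonneg _) h_intg).1 h0.symm
  let ε : I := ⟨θ / 2, by constructor <;> linarith⟩
  let ε' : I := ⟨1 - θ / 2, by constructor <;> linarith⟩
  have hε : (ε : ℝ) = θ / 2 := rfl
  have hε' : (ε' : ℝ) = 1 - θ / 2 := rfl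
  let j0 : Fin k := ⟨0, by omega⟩
  let j1 : Fin k := ⟨1, by omega⟩
  -- the pointwise bound for all indices but the first
  have hj : ∀ j, j ≠ j0 → ∀ w : I × I, w.1 < ε → projK nu (patK q) j w ≤ θ / 2 := by
    intro j hj w hw
    refine (proj_le q j j0 w (Set.Iio w.1 ×ˢ Set.univ) (measurableSet_Iio.prod MeasurableSet.univ)
      (fun z hz => ?_)).trans ?_
    · have hlt : j0 < j := by
        rw [Fin.lt_def]
        have : (j : ℕ) ≠ 0 := fun h => hj (Fin.ext h)
        simp only [j0]; omega
      have := hz.1 j0 j hlt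
      simp only [Function.update_self, Function.update_of_ne hj.symm] at this
      exact ⟨this, trivial⟩
    · rw [nu_real_prod]
      have h2 : (w.1 : ℝ) < θ / 2 := hw
      simp [measureReal_def, ENNReal.toReal_ofReal w.1.2.1]
      exact h2.le
  have key : ∀ T : Set I, 0 < volume.real T →
      (∀ w : I × I, w.2 ∈ T → projK nu (patK q) j0 w ≤ θ / 2) → False := by
    intro T hT hw
    have hpos : nu (Set.Iio ε ×ˢ T) ≠ 0 := by
      have : 0 < nu.real (Set.Iio ε ×ˢ T) := by
        rw [nu_real_prod]
        refine mul_pos ?_ hT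
        simp [measureReal_def, hε]
        rw [ENNReal.toReal_ofReal (by linarith)]
        linarith
      intro h
      simp [measureReal_def, h] at this
    have hex : ∃ w, w ∈ Set.Iio ε ×ˢ T ∧ gK nu (patK q) w ^ 2 = 0 := by
      by_contra hcon
      push Not at hcon
      apply hpos
      refine measure_mono_null (fun w hwm => ?_) h1
      exact fun h => hcon w hwm h
    obtain ⟨w, hwm, hw0⟩ := hex
    have hg0 : gK nu (patK q) w = 0 := by simpa using hw0
    have : gK nu (patK q) w < 0 := by
      unfold gK
      refine Finset.sum_neg (fun j _ => ?_) ⟨j0, Finset.mem_univ _⟩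
      by_cases hjj : j = j0
      · have := hw w hwm.2
        rw [hjj]; linarith
      · have := hj j hjj w hwm.1
        linarith
    linarith
  by_cases hq : q j0 = j0
  · -- the first entry is minimal: use points close to the top
    refine key (Set.Ioi ε') ?_ fun w hw => ?_
    · simp [measureReal_def, hε']
      rw [ENNReal.toReal_ofReal (by linarith)]
      linarith
    · have hne : j1 ≠ j0 := by simp [j0, j1, Fin.ext_iff]
      refine (proj_le q j0 j1 w (Set.univ ×ˢ Set.Ioi w.2)
        (MeasurableSet.univ.prod measurableSet_Ioi) (fun z hz => ?_)).trans ?_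
      · have hlt : q j0 < q j1 := by
          rw [hq, Fin.lt_def]
          have : (q j1 : ℕ) ≠ 0 := fun h =>
            hne (q.injective ((Fin.ext h : q j1 = j0).trans hq.symm))
          simp only [j0]; omega
        have := (hz.2 j0 j1).1 hlt
        simp only [Function.update_self, Function.update_of_ne hne] at this
        exact ⟨trivial, this⟩
      · rw [nu_real_prod]
        have h2 : 1 - θ / 2 < (w.2 : ℝ) := hw
        have h3 : (0 : ℝ) ≤ 1 - w.2 := by linarith [w.2.2.2]
        simp [measureReal_def, ENNReal.toReal_ofReal h3]
        linarith
  · refine key (Set.Iio ε) ?_ fun w hw => ?_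
    · simp [measureReal_def, hε]
      rw [ENNReal.toReal_ofReal (by linarith)]
      linarith
    · have hne : q.symm j0 ≠ j0 := fun h => hq ((Equiv.symm_apply_eq q).1 h).symm
      refine (proj_le q j0 (q.symm j0) w (Set.univ ×ˢ Set.Iio w.2)
        (MeasurableSet.univ.prod measurableSet_Iio) (fun z hz => ?_)).trans ?_
      · have hlt : q (q.symm j0) < q j0 := by
          rw [Equiv.apply_symm_apply, Fin.lt_def]
          have : (q j0 : ℕ) ≠ 0 := fun h => hq (Fin.ext h)
          simp only [j0] at this ⊢; omega
        have := (hz.2 (q.symm j0) j0).1 hlt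
        simp only [Function.update_self, Function.update_of_ne hne] at this
        exact ⟨trivial, this⟩
      · rw [nu_real_prod]
        have h2 : (w.2 : ℝ) < θ / 2 := hw
        simp [measureReal_def, ENNReal.toReal_ofReal w.2.2.1]
        exact h2.le

end PatCLT

/-- The standardized number of occurrences of a fixed pattern `q` of length `k ≥ 2`
in a uniformly random permutation of length `n` converges in distribution to the
standard normal distribution: for every bounded continuous test function `f`, the
expectation of `f` of the standardized count converges to `∫ f dN(0,1)`. -/
theorem occurrences_asymptotically_normal (k : ℕ) (hk : 2 ≤ k) (q : Equiv.Perm (Fin k))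
    (f : BoundedContinuousFunction ℝ ℝ) :
    Tendsto (fun n : ℕ =>
        (∑ p : Equiv.Perm (Fin n),
          f (((occCount q p : ℝ) - meanOcc k n q) / Real.sqrt (varOcc k n q)))
          / (n.factorial : ℝ))
      atTop (nhds (∫ x, f x ∂(ProbabilityTheory.gaussianReal 0 1))) := by
  
  classical
  have hclt := PatCLT.ustat_clt PatCLT.nu (PatCLT.patK q) (PatCLT.patK_measurable q)
    (PatCLT.patK_bound q) (by omega) (PatCLT.nondeg hk q)
  have h1 := (MeasureTheory.ProbabilityMeasure.tendsto_iff_forall_integral_tendsto.1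
    hclt.tendsto) f
  simp only [MeasureTheory.ProbabilityMeasure.coe_mk, MeasureTheory.Measure.map_id] at h1
  refine h1.congr fun n => ?_
  rw [MeasureTheory.integral_map (hclt.forall_aemeasurable n)
    f.continuous.measurable.aestronglyMeasurable]
  rw [← PatCLT.var_eq, ← PatCLT.mean_eq]
  have hF : Measurable (fun x : ℝ => f ((x - meanOcc k n q) / Real.sqrt (varOcc k n q))) :=
    f.continuous.measurable.comp (by fun_prop)
  have h2 := PatCLT.mp_int (PatCLT.restr_mp PatCLT.nu n)
    (F := fun z => f ((PatCLT.stat (PatCLT.patK q) n z - meanOcc k n q) /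
      Real.sqrt (varOcc k n q)))
    (hF.comp (PatCLT.stat_measurable _ (PatCLT.patK_measurable q) n))
  refine h2.trans ?_
  exact PatCLT.expect_eq q _ hF ‖f‖ (fun z => f.norm_coe_le_norm _)
end

section
/- Let q be a fixed permutation pattern of length k ≥ 2, and for each n let X_n be the random variable counting the occurrences of q in a uniformly random permutation of length n. Then there exists a positive constant C such that for all sufficiently large n, the standard deviation σ_n = sqrt(Var(X_n)) satisfies σ_n > C·n^{k−1/2}. -/
open Finset Filter

open scoped Classical in
/-- sign of `y - x` -/
noncomputable def sg {n : ℕ} (x y : Fin n) : ℝ := if x < y then 1 else if y < x then -1 else 0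

open scoped Classical in
/-- indicator that `x` is order isomorphic to `q` -/
noncomputable def pind {k n : ℕ} (q : Equiv.Perm (Fin k)) (x : Fin k → Fin n) : ℝ :=
  if (∀ j r : Fin k, q j < q r ↔ x j < x r) then 1 else 0

lemma sg_anti {n : ℕ} (x y : Fin n) : sg y x = - sg x y := by
  unfold sg
  rcases lt_trichotomy x y with h | h | h
  · simp [h, h.not_gt]
  · simp [h]
  · simp [h, h.not_gt]

lemma sg_abs {n : ℕ} (x y : Fin n) : |sg x y| ≤ 1 := by
  unfold sg
  split_ifs <;> simp

lemma sg_mono {n m : ℕ} (y : Fin m → Fin n) (hy : StrictMono y) (a b : Fin m) :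
    sg (y a) (y b) = sg a b := by
  unfold sg; simp only [hy.lt_iff_lt]

lemma pind_mono {k n m : ℕ} (q : Equiv.Perm (Fin k)) (y : Fin m → Fin n) (hy : StrictMono y)
    (x : Fin k → Fin m) : pind q (fun i => y (x i)) = pind q x := by
  unfold pind; simp only [hy.lt_iff_lt]

lemma pind_nonneg {k n : ℕ} (q : Equiv.Perm (Fin k)) (x : Fin k → Fin n) : 0 ≤ pind q x := by
  unfold pind; split_ifs <;> simp

lemma pind_le {k n : ℕ} (q : Equiv.Perm (Fin k)) (x : Fin k → Fin n) : pind q x ≤ 1 := by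
  unfold pind; split_ifs <;> simp

lemma pind_sg_abs {k n : ℕ} (q : Equiv.Perm (Fin k)) (x : Fin k → Fin n) (a b : Fin n) :
    |pind q x * sg a b| ≤ 1 := by
  rw [abs_mul, abs_of_nonneg (pind_nonneg q x)]
  exact mul_le_one₀ (pind_le q x) (abs_nonneg _) (sg_abs a b)

lemma perm_sum {m n : ℕ} (s : Fin m ↪ Fin n) (G : (Fin m → Fin n) → ℝ) (c : ℝ)
    (hG : ∀ x : Fin m → Fin n, Function.Injective x →
      ∑ τ : Equiv.Perm (Fin m), G (fun i => x (τ i)) = c) :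
    ∑ p : Equiv.Perm (Fin n), G (fun i => p (s i)) = n.factorial * (c / m.factorial) := by
  have h1 : ∀ τ : Equiv.Perm (Fin m), ∑ p : Equiv.Perm (Fin n), G (fun i => p (s i)) =
      ∑ p : Equiv.Perm (Fin n), G (fun i => p (s (τ i))) := by
    intro τ
    symm
    apply Fintype.sum_equiv (Equiv.mulRight (τ.viaEmbedding s))
    intro p
    simp [Equiv.Perm.viaEmbedding_apply]
  have h2 : ∑ τ : Equiv.Perm (Fin m), ∑ p : Equiv.Perm (Fin n), G (fun i => p (s i)) =
      n.factorial * c := by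
    rw [Finset.sum_congr rfl (fun τ _ => h1 τ), Finset.sum_comm,
      Finset.sum_congr rfl (fun p _ => hG (fun i => p (s i)) (p.injective.comp s.injective))]
    simp [Fintype.card_perm]
  simp only [Finset.sum_const, Finset.card_univ, Fintype.card_perm, Fintype.card_fin,
    nsmul_eq_mul] at h2
  have : (m.factorial : ℝ) ≠ 0 := by positivity
  field_simp
  linarith

lemma const_of_order {m n : ℕ} (G : (Fin m → Fin n) → ℝ) (F : (Fin m → Fin m) → ℝ)
    (h : ∀ (y : Fin m → Fin n), StrictMono y → ∀ x : Fin m → Fin m, G (fun i => y (x i)) = F x)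
    (x : Fin m → Fin n) (hx : Function.Injective x) :
    ∑ τ : Equiv.Perm (Fin m), G (fun i => x (τ i)) = ∑ τ : Equiv.Perm (Fin m), F τ := by
  have hy : StrictMono (x ∘ Tuple.sort x) :=
    (Tuple.monotone_sort x).strictMono_of_injective (hx.comp (Tuple.sort x).injective)
  rw [← Fintype.sum_equiv (Equiv.mulLeft (Tuple.sort x))
    (fun τ => G (fun i => x ((Tuple.sort x * τ) i))) _ (fun τ => rfl)]
  refine Finset.sum_congr rfl fun τ _ => ?_
  exact h _ hy τ

/-- the constant `T_j` -/
noncomputable def Tc {k : ℕ} (q : Equiv.Perm (Fin k)) (j : Fin k) : ℝ :=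
  (∑ τ : Equiv.Perm (Fin (k+1)), pind q (fun i => τ (Fin.castSucc i)) *
    sg (τ (Fin.castSucc j)) (τ (Fin.last k))) / (k+1).factorial

lemma sum_T {k n : ℕ} (q : Equiv.Perm (Fin k)) (ι : Fin k → Fin n) (hι : Function.Injective ι)
    (b : Fin n) (hb : ∀ i, ι i ≠ b) (j : Fin k) :
    ∑ p : Equiv.Perm (Fin n), pind q (fun i => p (ι i)) * sg (p (ι j)) (p b) =
      n.factorial * Tc q j := by
  have hs : Function.Injective (Fin.snoc (α := fun _ => Fin n) ι b) := by
    rw [Fin.snoc_injective_iff]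
    exact ⟨hι, by rintro ⟨i, hi⟩; exact hb i hi⟩
  have := perm_sum ⟨_, hs⟩
    (fun x => pind q (fun i => x (Fin.castSucc i)) * sg (x (Fin.castSucc j)) (x (Fin.last k)))
    _ (const_of_order (fun x => pind q (fun i => x (Fin.castSucc i)) *
      sg (x (Fin.castSucc j)) (x (Fin.last k))) (fun x => pind q (fun i => x (Fin.castSucc i)) *
      sg (x (Fin.castSucc j)) (x (Fin.last k))) (by
        intro y hy x
        simp only [sg_mono y hy]
        rw [pind_mono q y hy (fun i => x (Fin.castSucc i))]))
  simpa [Tc] using this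

lemma Tc_lt {k : ℕ} (q : Equiv.Perm (Fin k)) (i j : Fin k) (hij : q i < q j) :
    Tc q j < Tc q i := by
  unfold Tc
  apply div_lt_div_of_pos_right _ (by positivity)
  apply Finset.sum_lt_sum
  · intro τ _
    unfold pind
    split_ifs with h
    · have h1 : τ i.castSucc < τ j.castSucc := (h i j).1 hij
      unfold sg
      split_ifs <;> first | (exfalso; omega) | norm_num
    · simp
  · let f : Fin (k+1) → Fin (k+1) :=
      Fin.snoc (α := fun _ => Fin (k+1)) (fun r => (q i).succ.succAbove (q r)) (q i).succ
    have hf : Function.Injective f := by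
      rw [Fin.snoc_injective_iff]
      refine ⟨Fin.succAbove_right_injective.comp q.injective, ?_⟩
      rintro ⟨r, hr⟩
      exact Fin.succAbove_ne _ _ hr
    refine ⟨Equiv.ofBijective f (Finite.injective_iff_bijective.1 hf), Finset.mem_univ _, ?_⟩
    have e1 : ∀ r, f (Fin.castSucc r) = (q i).succ.succAbove (q r) := by intro r; simp [f]
    have e2 : f (Fin.last k) = (q i).succ := by simp [f]
    simp only [Equiv.ofBijective_apply, e1, e2]
    have h1 : pind q (fun r => (q i).succ.succAbove (q r)) = 1 := by
      unfold pind
      simp [Fin.succAbove_lt_succAbove_iff]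
    have h2 : (q i).succ.succAbove (q i) < (q i).succ := by
      rw [Fin.succAbove_of_castSucc_lt] <;> simp
    have h3 : (q i).succ < (q i).succ.succAbove (q j) := by
      rw [Fin.succAbove_of_le_castSucc]
      · simpa using hij
      · rw [Fin.le_def]; simpa using hij
    rw [h1]
    unfold sg
    simp [h3, h3.not_gt]

lemma Tc_ne {k : ℕ} (q : Equiv.Perm (Fin k)) (i j : Fin k) (hij : i ≠ j) :
    Tc q i - Tc q j ≠ 0 := by
  rcases lt_or_gt_of_ne (fun h => hij (q.injective h)) with h | h
  · have := Tc_lt q i j h; intro h'; linarith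
  · have := Tc_lt q j i h; intro h'; linarith

lemma sum_swap {k n : ℕ} (q : Equiv.Perm (Fin k)) (ι : Fin k → Fin n)
    (a b : Fin n) (ha : ∀ i, ι i ≠ a) (hb : ∀ i, ι i ≠ b) :
    ∑ p : Equiv.Perm (Fin n), pind q (fun i => p (ι i)) * sg (p a) (p b) = 0 := by
  have h : ∑ p : Equiv.Perm (Fin n), pind q (fun i => p (ι i)) * sg (p a) (p b) =
     ∑ p : Equiv.Perm (Fin n), -(pind q (fun i => p (ι i)) * sg (p a) (p b)) := by
    apply Fintype.sum_equiv (Equiv.mulRight (Equiv.swap a b))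
    intro p
    simp only [Equiv.coe_mulRight, Equiv.Perm.mul_apply, Equiv.swap_apply_left,
      Equiv.swap_apply_right]
    rw [sg_anti (p a) (p b)]
    have : ∀ i, Equiv.swap a b (ι i) = ι i := fun i =>
      Equiv.swap_apply_of_ne_of_ne (ha i) (hb i)
    simp only [this]; ring
  rw [Finset.sum_neg_distrib] at h
  linarith

lemma sum_chi {n : ℕ} (a b : Fin n) :
    ∑ p : Equiv.Perm (Fin n), sg (p a) (p b) = 0 := by
  have h : ∑ p : Equiv.Perm (Fin n), sg (p a) (p b) =
     ∑ p : Equiv.Perm (Fin n), -(sg (p a) (p b)) := by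
    apply Fintype.sum_equiv (Equiv.mulRight (Equiv.swap a b))
    intro p
    simp only [Equiv.coe_mulRight, Equiv.Perm.mul_apply, Equiv.swap_apply_left,
      Equiv.swap_apply_right]
    rw [sg_anti (p a) (p b)]
    ring
  rw [Finset.sum_neg_distrib] at h
  linarith

lemma sum_chi_chi {n : ℕ} (a b c d : Fin n) (h1 : c ≠ a) (h2 : c ≠ b) (h3 : d ≠ a) (h4 : d ≠ b) :
    ∑ p : Equiv.Perm (Fin n), sg (p a) (p b) * sg (p c) (p d) = 0 := by
  have h : ∑ p : Equiv.Perm (Fin n), sg (p a) (p b) * sg (p c) (p d) =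
     ∑ p : Equiv.Perm (Fin n), -(sg (p a) (p b) * sg (p c) (p d)) := by
    apply Fintype.sum_equiv (Equiv.mulRight (Equiv.swap a b))
    intro p
    simp only [Equiv.coe_mulRight, Equiv.Perm.mul_apply, Equiv.swap_apply_left,
      Equiv.swap_apply_right, Equiv.swap_apply_of_ne_of_ne h1 h2,
      Equiv.swap_apply_of_ne_of_ne h3 h4]
    rw [sg_anti (p a) (p b)]
    ring
  rw [Finset.sum_neg_distrib] at h
  linarith

lemma perm_sum_abs_le {n : ℕ} (f : Equiv.Perm (Fin n) → ℝ) (hf : ∀ p, |f p| ≤ 1) :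
    |∑ p, f p| ≤ n.factorial := by
  refine (Finset.abs_sum_le_sum_abs _ _).trans ?_
  refine (Finset.sum_le_sum fun p _ => hf p).trans ?_
  simp [Fintype.card_perm]

open scoped Classical in
lemma occ_eq {k n : ℕ} (q : Equiv.Perm (Fin k)) (p : Equiv.Perm (Fin n)) :
    (occCount q p : ℝ) = ∑ ι ∈ univ.filter (fun ι : Fin k → Fin n => StrictMono ι),
      pind q (fun i => p (ι i)) := by
  unfold occCount pind
  rw [Finset.sum_boole, Finset.filter_filter]
  norm_cast

open scoped Classical in
lemma card_two {k n : ℕ} (i j : Fin k) (hij : i ≠ j) (U S : Finset (Fin n)) :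
    (univ.filter (fun ι : Fin k → Fin n => ι i ∈ U ∧ ι j ∈ S)).card ≤
      U.card * S.card * n ^ (k - 2) := by
  have h : (univ.filter (fun ι : Fin k → Fin n => ι i ∈ U ∧ ι j ∈ S)) ⊆
      Fintype.piFinset (fun r => if r = i then U else if r = j then S else univ) := by
    intro ι hι
    simp only [mem_filter, mem_univ, true_and] at hι
    rw [Fintype.mem_piFinset]
    intro r
    by_cases h1 : r = i
    · subst h1; simp [hι.1]
    · by_cases h2 : r = j
      · subst h2; simp [h1, hι.2]
      · simp [h1, h2]
  refine (Finset.card_le_card h).trans ?_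
  rw [Fintype.card_piFinset, ← Finset.mul_prod_erase univ _ (mem_univ i),
    ← Finset.mul_prod_erase (univ.erase i) _ (Finset.mem_erase.2 ⟨hij.symm, mem_univ j⟩),
    Finset.prod_congr rfl (g := fun _ => n)]
  · rw [Finset.prod_const, Finset.card_erase_of_mem (Finset.mem_erase.2 ⟨hij.symm, mem_univ j⟩),
      Finset.card_erase_of_mem (mem_univ i)]
    simp [hij.symm, mul_assoc, Nat.sub_sub]
  · intro r hr
    simp only [mem_erase, mem_univ, and_true] at hr
    simp [hr.1, hr.2]

/-- exceptional index maps -/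
def Rp {k n : ℕ} (a b : Fin n) (ι : Fin k → Fin n) : Prop :=
  ∃ i j, i ≠ j ∧ (ι i = a ∨ ι i = b) ∧ (ι j ≤ a ∨ b ≤ ι j)

open scoped Classical in
lemma card_R {k n m : ℕ} (a b : Fin n) (ha : a.val < m) (hb : n ≤ b.val + m) :
    (univ.filter (fun ι : Fin k → Fin n => Rp a b ι)).card ≤ 4 * k ^ 2 * m * n ^ (k - 2) := by
  have h : (univ.filter (fun ι : Fin k → Fin n => Rp a b ι)) ⊆
      (univ : Finset (Fin k)).offDiag.biUnion (fun x => univ.filter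
        (fun ι : Fin k → Fin n => ι x.1 ∈ ({a, b} : Finset (Fin n)) ∧
          ι x.2 ∈ Finset.Iic a ∪ Finset.Ici b)) := by
    intro ι hι
    simp only [mem_filter, mem_univ, true_and] at hι
    obtain ⟨i, j, h1, h2, h3⟩ := hι
    simp only [mem_biUnion, mem_filter, mem_univ, true_and, mem_offDiag, mem_insert,
      mem_singleton, mem_union, mem_Iic, mem_Ici]
    exact ⟨(i, j), h1, h2, h3⟩
  refine (Finset.card_le_card h).trans ?_
  refine (Finset.card_biUnion_le_card_mul _ _ (2 * (2 * m) * n ^ (k - 2)) ?_).trans ?_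
  · intro x hx
    refine (card_two x.1 x.2 (by simpa using hx) _ _).trans ?_
    have h1 : ({a, b} : Finset (Fin n)).card ≤ 2 := Finset.card_le_two
    have h2 : (Finset.Iic a ∪ Finset.Ici b).card ≤ 2 * m := by
      refine (Finset.card_union_le _ _).trans ?_
      rw [Fin.card_Iic, Fin.card_Ici]; omega
    gcongr
  · have : (univ : Finset (Fin k)).offDiag.card ≤ k ^ 2 := by
      rw [Finset.offDiag_card]; simp [sq]
    calc _ ≤ k ^ 2 * (2 * (2 * m) * n ^ (k - 2)) := by gcongr
      _ = _ := by ring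

/-- index maps starting at `a` and avoiding `b` -/
def Ap {k n : ℕ} (i : Fin k) (a b : Fin n) (ι : Fin k → Fin n) : Prop :=
  ι i = a ∧ ∀ j, ι j ≠ b

open scoped Classical in
lemma card_A_eq {k n : ℕ} (i : Fin k) (a : Fin n) :
    (univ.filter (fun ι : Fin k → Fin n => StrictMono ι ∧ Ap i a a.rev ι)).card =
    (univ.filter (fun ι : Fin k → Fin n => StrictMono ι ∧ Ap i.rev a.rev a ι)).card := by
  apply Finset.card_nbij' (fun ι r => (ι r.rev).rev) (fun ι r => (ι r.rev).rev)
  · intro ι hι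
    rw [Finset.mem_coe, Finset.mem_filter] at hι ⊢
    replace hι := hι.2
    refine ⟨mem_univ _, ?_⟩
    refine ⟨fun x y hxy => ?_, by simp [hι.2.1], fun j hj => hι.2.2 j.rev ?_⟩
    · rw [Fin.rev_lt_rev]; exact hι.1 (Fin.rev_lt_rev.2 hxy)
    · rw [← hj, Fin.rev_rev]
  · intro ι hι
    rw [Finset.mem_coe, Finset.mem_filter] at hι ⊢
    replace hι := hι.2
    refine ⟨mem_univ _, ?_⟩
    refine ⟨fun x y hxy => ?_, by simp [hι.2.1], fun j hj => hι.2.2 j.rev ?_⟩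
    · rw [Fin.rev_lt_rev]; exact hι.1 (Fin.rev_lt_rev.2 hxy)
    · rw [← Fin.rev_inj]; exact hj
  · intro ι _; simp
  · intro ι _; simp

open scoped Classical in
lemma card_A_ge {k n L : ℕ} (i : Fin k) (hi : i.val = 0) (a : Fin n) (ha : a.val < L)
    (hL : (k + 1) * L ≤ n) :
    L ^ (k - 1) ≤
    (univ.filter (fun ι : Fin k → Fin n => StrictMono ι ∧ Ap i a a.rev ι)).card := by
  have hb : ∀ r : Fin k, (r.val + 1) * L ≤ k * L := fun r => Nat.mul_le_mul_right _ r.isLt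
  have hL' : k * L + L ≤ n := by linarith
  let B : Fin k → Finset (Fin n) := fun r => if r = i then {a} else
    univ.filter (fun x : Fin n => r.val * L ≤ x.val ∧ x.val < (r.val + 1) * L)
  have hB : ∀ r (x : Fin n), x ∈ B r → r.val * L ≤ x.val ∧ x.val < (r.val + 1) * L := by
    intro r x hx
    by_cases h : r = i
    · subst h
      simp only [B, if_true, mem_singleton] at hx
      subst hx
      simp [hi, ha]
    · simpa [B, h] using hx
  have hsub : Fintype.piFinset B ⊆
      (univ.filter (fun ι : Fin k → Fin n => StrictMono ι ∧ Ap i a a.rev ι)) := by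
    intro ι hι
    rw [Fintype.mem_piFinset] at hι
    simp only [mem_filter, mem_univ, true_and]
    refine ⟨fun x y hxy => ?_, by simpa [B] using hι i, fun j hj => ?_⟩
    · have h1 := (hB x _ (hι x)).2
      have h2 := (hB y _ (hι y)).1
      have h3 : (x.val + 1) * L ≤ y.val * L := Nat.mul_le_mul_right _ hxy
      rw [Fin.lt_def]; omega
    · have h1 := (hB j _ (hι j)).2
      have h2 := hb j
      rw [hj, Fin.val_rev] at h1
      omega
  refine le_trans ?_ (Finset.card_le_card hsub)
  rw [Fintype.card_piFinset, ← Finset.mul_prod_erase univ _ (mem_univ i),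
    Finset.prod_congr rfl (g := fun _ => L)]
  · simp [B]
  · intro r hr
    have hr' : r ≠ i := by simpa using hr
    simp only [B, if_neg hr']
    have e : (univ.filter (fun x : Fin n => r.val * L ≤ x.val ∧ x.val < (r.val + 1) * L)).card =
        (Finset.Ico (r.val * L) ((r.val + 1) * L)).card := by
      rw [← Finset.card_map Fin.valEmbedding]
      congr 1
      ext x
      simp only [Finset.mem_map, mem_filter, mem_univ, true_and, Fin.valEmbedding_apply, mem_Ico]
      constructor
      · rintro ⟨y, hy, rfl⟩; exact hy
      · intro hx
        have := hb r
        exact ⟨⟨x, by omega⟩, hx, rfl⟩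
    rw [e, Nat.card_Ico, Nat.succ_mul]; omega

open scoped Classical in
lemma pointwise {k n : ℕ} (q : Equiv.Perm (Fin k)) (i0 il : Fin k) (h0 : i0.val = 0)
    (hl : il.val + 1 = k) (a b : Fin n) (hab : a ≠ b) (ι : Fin k → Fin n) (hι : StrictMono ι) :
    |∑ p : Equiv.Perm (Fin n), pind q (fun i => p (ι i)) * sg (p a) (p b) -
      n.factorial * ((if Ap i0 a b ι then Tc q i0 else 0) - (if Ap il b a ι then Tc q il else 0))|
      ≤ n.factorial * (if Rp a b ι then 1 else 0) := by
  by_cases hA : Ap i0 a b ι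
  · have hA2 : ¬ Ap il b a ι := fun h => h.2 i0 hA.1
    have := sum_T q ι hι.injective b hA.2 i0
    rw [hA.1] at this
    rw [if_pos hA, if_neg hA2, this]
    simp only [sub_zero, sub_self, abs_zero]
    split_ifs <;> positivity
  by_cases hA2 : Ap il b a ι
  · have := sum_T q ι hι.injective a hA2.2 il
    rw [hA2.1] at this
    rw [if_neg hA, if_pos hA2, Finset.sum_congr rfl
      (g := fun p => -(pind q (fun i => p (ι i)) * sg (p b) (p a)))
      (fun p _ => by rw [sg_anti (p b) (p a)]; ring), Finset.sum_neg_distrib, this]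
    have : -((n.factorial : ℝ) * Tc q il) - n.factorial * (0 - Tc q il) = 0 := by ring
    rw [this, abs_zero]
    split_ifs <;> positivity
  rw [if_neg hA, if_neg hA2]
  simp only [sub_zero, mul_zero]
  by_cases hR : Rp a b ι
  · rw [if_pos hR, mul_one]
    exact perm_sum_abs_le _ (fun p => pind_sg_abs q _ _ _)
  · rw [if_neg hR, sum_swap]
    · simp
    · intro i hi
      by_cases h : i = i0
      · apply hA
        rw [h] at hi
        refine ⟨hi, fun j hj => hR ⟨i0, j, ?_, Or.inl hi, Or.inr hj.ge⟩⟩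
        rintro rfl
        exact hab (hi.symm.trans hj)
      · refine hR ⟨i, i0, h, Or.inl hi, Or.inl ?_⟩
        rw [← hi]
        exact hι.monotone (by rw [Fin.le_def]; omega)
    · intro i hi
      by_cases h : i = il
      · apply hA2
        rw [h] at hi
        refine ⟨hi, fun j hj => hR ⟨il, j, ?_, Or.inr hi, Or.inl hj.le⟩⟩
        rintro rfl
        exact hab (hj.symm.trans hi)
      · refine hR ⟨i, il, h, Or.inr hi, Or.inr ?_⟩
        rw [← hi]
        exact hι.monotone (by rw [Fin.le_def]; omega)

open scoped Classical in
lemma cov_s {k n m : ℕ} (q : Equiv.Perm (Fin k)) (i0 : Fin k) (h0 : i0.val = 0)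
    (a : Fin n) (ha : a.val < m) (hm : 2 * m ≤ n) :
    |∑ p : Equiv.Perm (Fin n), (occCount q p : ℝ) * sg (p a) (p a.rev) -
      n.factorial * ((univ.filter (fun ι : Fin k → Fin n =>
        StrictMono ι ∧ Ap i0 a a.rev ι)).card * (Tc q i0 - Tc q i0.rev))|
      ≤ n.factorial * (4 * k ^ 2 * m * n ^ (k - 2) : ℕ) := by
  have hab : a ≠ a.rev := by
    intro h
    have := congrArg Fin.val h
    rw [Fin.val_rev] at this
    omega
  have hR := card_R (k := k) a a.rev ha (by rw [Fin.val_rev]; omega)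
  have e1 : ∑ p : Equiv.Perm (Fin n), (occCount q p : ℝ) * sg (p a) (p a.rev) =
      ∑ ι ∈ univ.filter (fun ι : Fin k → Fin n => StrictMono ι),
        ∑ p : Equiv.Perm (Fin n), pind q (fun i => p (ι i)) * sg (p a) (p a.rev) := by
    rw [Finset.sum_comm]
    refine Finset.sum_congr rfl fun p _ => ?_
    rw [occ_eq, Finset.sum_mul]
  have e2 : (n.factorial : ℝ) * ((univ.filter (fun ι : Fin k → Fin n =>
        StrictMono ι ∧ Ap i0 a a.rev ι)).card * (Tc q i0 - Tc q i0.rev)) =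
      ∑ ι ∈ univ.filter (fun ι : Fin k → Fin n => StrictMono ι),
        n.factorial * ((if Ap i0 a a.rev ι then Tc q i0 else 0) -
          (if Ap i0.rev a.rev a ι then Tc q i0.rev else 0)) := by
    rw [← Finset.mul_sum, Finset.sum_sub_distrib, ← Finset.sum_filter, ← Finset.sum_filter,
      Finset.filter_filter, Finset.filter_filter, Finset.sum_const, Finset.sum_const,
      ← card_A_eq]
    simp only [nsmul_eq_mul]
    ring
  rw [e1, e2, ← Finset.sum_sub_distrib]
  refine (Finset.abs_sum_le_sum_abs _ _).trans ?_
  refine (Finset.sum_le_sum (fun ι hι => pointwise q i0 i0.rev h0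
    (by rw [Fin.val_rev]; omega) a a.rev hab ι (by simpa using hι))).trans ?_
  rw [← Finset.mul_sum, Finset.sum_boole, Finset.filter_filter]
  gcongr
  refine le_trans (Finset.card_le_card ?_) hR
  intro ι
  simp only [mem_filter, mem_univ, true_and]
  exact fun h => h.2

open scoped Classical in
lemma var_ge {k : ℕ} (hk : 2 ≤ k) (q : Equiv.Perm (Fin k)) :
    ∃ M : ℕ, 1 ≤ M ∧ ∀ n : ℕ, M ≤ n → ((n / M : ℕ) : ℝ) ^ (2 * k - 1) ≤ varOcc k n q := by
  let i0 : Fin k := ⟨0, by omega⟩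
  have hi : i0 ≠ i0.rev := by
    intro h
    have := congrArg Fin.val h
    rw [Fin.val_rev] at this
    simp [i0] at this
    omega
  obtain ⟨d, hd⟩ : ∃ d, d = Tc q i0 - Tc q i0.rev := ⟨_, rfl⟩
  have hd0 : d ≠ 0 := hd ▸ Tc_ne q _ _ hi
  have hdp : 0 < |d| := abs_pos.2 hd0
  obtain ⟨K, hK⟩ := exists_nat_ge (((4 * k ^ 2 * (2 * (k + 1)) ^ (k - 2) : ℕ) + 1 : ℝ) / |d|)
  rw [div_le_iff₀ hdp] at hK
  have hK1 : 1 ≤ K := by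
    rcases Nat.eq_zero_or_pos K with h | h
    · subst h
      have : (0:ℝ) ≤ ((4 * k ^ 2 * (2 * (k + 1)) ^ (k - 2) : ℕ) : ℝ) := by positivity
      rw [Nat.cast_zero, zero_mul] at hK
      linarith
    · exact h
  have hM1 : 1 ≤ K * (k + 1) := Nat.mul_pos hK1 (by omega)
  refine ⟨K * (k + 1), hM1, fun n hn => ?_⟩
  obtain ⟨m, hm⟩ : ∃ m, m = n / (K * (k + 1)) := ⟨_, rfl⟩
  rw [← hm]
  have hm1 : 1 ≤ m := by rw [hm]; exact Nat.div_pos hn hM1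
  have hmn : (k + 1) * (K * m) ≤ n := by
    have := Nat.div_mul_le_self n (K * (k + 1))
    rw [← hm] at this
    linarith
  have hmn2 : n ≤ 2 * (k + 1) * (K * m) := by
    have := Nat.lt_mul_div_succ n (show 0 < K * (k + 1) from hM1)
    rw [← hm] at this
    nlinarith
  have hmK : m ≤ K * m := Nat.le_mul_of_pos_left _ hK1
  have h2m : 2 * m ≤ n := by nlinarith
  -- the main estimate
  have main : ∀ a : Fin n, a.val < m → (n.factorial : ℝ) * |d| * (m : ℝ) ^ (k - 1) ≤
      d * ∑ p : Equiv.Perm (Fin n), (occCount q p : ℝ) * sg (p a) (p a.rev) := by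
    intro a ha
    have h1 := cov_s q i0 rfl a ha h2m
    have h2 := card_A_ge (k := k) i0 rfl a (lt_of_lt_of_le ha hmK) hmn
    rw [← hd] at h1
    set A := (univ.filter (fun ι : Fin k → Fin n => StrictMono ι ∧ Ap i0 a a.rev ι)).card with hA
    clear_value A
    set E := ∑ p : Equiv.Perm (Fin n), (occCount q p : ℝ) * sg (p a) (p a.rev) with hE
    clear_value E
    have h3 : (4 * k ^ 2 * m * n ^ (k - 2) : ℕ) ≤
        (4 * k ^ 2 * (2 * (k + 1)) ^ (k - 2)) * (K ^ (k - 2) * m ^ (k - 1)) := by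
      calc 4 * k ^ 2 * m * n ^ (k - 2) ≤ 4 * k ^ 2 * m * (2 * (k + 1) * (K * m)) ^ (k - 2) := by
            gcongr
        _ = _ := by
            have : k - 1 = (k - 2) + 1 := by omega
            rw [this, mul_pow, mul_pow, pow_succ]; ring
    set B : ℕ := 4 * k ^ 2 * (2 * (k + 1)) ^ (k - 2) with hB
    set R : ℕ := 4 * k ^ 2 * m * n ^ (k - 2) with hR
    clear_value B R
    have h2' : ((K : ℝ) * (K ^ (k - 2) * m ^ (k - 1))) ≤ A := by
      have : (K * m) ^ (k - 1) = K * (K ^ (k - 2) * m ^ (k - 1)) := by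
        have : k - 1 = (k - 2) + 1 := by omega
        rw [this, mul_pow, pow_succ K]; ring
      rw [this] at h2
      exact_mod_cast h2
    have h3' : (R : ℝ) ≤ B * (K ^ (k - 2) * m ^ (k - 1)) := by exact_mod_cast h3
    have h4 : (m : ℝ) ^ (k - 1) ≤ K ^ (k - 2) * m ^ (k - 1) := by
      have : (1 : ℝ) ≤ (K : ℝ) ^ (k - 2) := one_le_pow₀ (by exact_mod_cast hK1)
      have h' : (0 : ℝ) ≤ (m : ℝ) ^ (k - 1) := by positivity
      nlinarith
    set W : ℝ := K ^ (k - 2) * m ^ (k - 1) with hW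
    have hW0 : 0 ≤ W := by positivity
    clear_value W
    have h5 : (m : ℝ) ^ (k - 1) ≤ A * |d| - R := by
      nlinarith [mul_le_mul_of_nonneg_right h2' hdp.le, mul_le_mul_of_nonneg_right hK hW0]
    have hf : (0 : ℝ) < n.factorial := by positivity
    have h6 : d * (n.factorial * (A * d) - E) ≤ |d| * (n.factorial * R) := by
      refine (le_abs_self _).trans ?_
      rw [abs_mul, abs_sub_comm]
      gcongr
    have h7 : d * d = |d| * |d| := (abs_mul_abs_self d).symm
    have h8 : d * (n.factorial * (A * d) - E) = n.factorial * A * (|d| * |d|) - d * E := by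
      rw [← h7]; ring
    have h9 := mul_le_mul_of_nonneg_left h5 (mul_nonneg hf.le hdp.le)
    rw [h8] at h6
    linarith
  let a : Fin m → Fin n := fun s => ⟨s.val, by omega⟩
  let Y : Equiv.Perm (Fin n) → ℝ := fun p => ∑ s : Fin m, sg (p (a s)) (p (a s).rev)
  have hY0 : ∑ p, Y p = 0 := by
    simp only [Y]
    rw [Finset.sum_comm]
    exact Finset.sum_eq_zero fun s _ => sum_chi _ _
  have hY2 : ∑ p, Y p ^ 2 ≤ n.factorial * m := by
    simp only [Y, sq, Finset.sum_mul_sum]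
    rw [Finset.sum_comm]
    have : ∀ s : Fin m, ∑ p : Equiv.Perm (Fin n), ∑ t : Fin m,
        sg (p (a s)) (p (a s).rev) * sg (p (a t)) (p (a t).rev) ≤ n.factorial := by
      intro s
      rw [Finset.sum_comm, Finset.sum_eq_single s]
      · refine (le_abs_self _).trans (perm_sum_abs_le _ fun p => ?_)
        rw [abs_mul]
        exact mul_le_one₀ (sg_abs _ _) (abs_nonneg _) (sg_abs _ _)
      · intro t _ hts
        have : t.val ≠ s.val := fun h => hts (Fin.ext h)
        have := t.isLt
        have := s.isLt
        apply sum_chi_chi <;> (intro h; have := congrArg Fin.val h; simp [a, Fin.val_rev] at this; omega)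
      · simp
    refine (Finset.sum_le_sum fun s _ => this s).trans ?_
    simp [mul_comm]
  have hXY : (n.factorial : ℝ) * |d| * (m : ℝ) ^ k ≤
      d * ∑ p : Equiv.Perm (Fin n), ((occCount q p : ℝ) - meanOcc k n q) * Y p := by
    have e : ∑ p : Equiv.Perm (Fin n), ((occCount q p : ℝ) - meanOcc k n q) * Y p =
        ∑ s : Fin m, ∑ p : Equiv.Perm (Fin n), (occCount q p : ℝ) * sg (p (a s)) (p (a s).rev) := by
      simp only [sub_mul, Finset.sum_sub_distrib]
      rw [← Finset.mul_sum, hY0, mul_zero, sub_zero, Finset.sum_comm]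
      simp only [Y, Finset.mul_sum]
    rw [e, Finset.mul_sum]
    refine le_trans ?_ (Finset.sum_le_sum fun s _ => main (a s) s.isLt)
    have : k = (k - 1) + 1 := by omega
    conv_lhs => rw [this, pow_succ]
    simp only [Finset.sum_const, Finset.card_univ, Fintype.card_fin, nsmul_eq_mul]
    apply le_of_eq; ring
  have hCS := Finset.sum_mul_sq_le_sq_mul_sq univ
    (fun p : Equiv.Perm (Fin n) => (occCount q p : ℝ) - meanOcc k n q) Y
  unfold varOcc
  set V := ∑ p : Equiv.Perm (Fin n), ((occCount q p : ℝ) - meanOcc k n q) ^ 2 with hV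
  have hV0 : 0 ≤ V := Finset.sum_nonneg fun p _ => sq_nonneg _
  clear_value V
  set S := ∑ p : Equiv.Perm (Fin n), ((occCount q p : ℝ) - meanOcc k n q) * Y p with hS
  clear_value S
  have hf : (0 : ℝ) < n.factorial := by positivity
  have hmp : (0 : ℝ) < m := by exact_mod_cast hm1
  rw [le_div_iff₀ hf]
  have h1 : (n.factorial : ℝ) * (m : ℝ) ^ k ≤ |S| := by
    have : d * S ≤ |d| * |S| := by rw [← abs_mul]; exact le_abs_self _
    have h' : |d| * ((n.factorial : ℝ) * (m : ℝ) ^ k) ≤ |d| * |S| := by linarith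
    exact le_of_mul_le_mul_left h' hdp
  have h2 : ((n.factorial : ℝ) * (m : ℝ) ^ k) ^ 2 ≤ V * (n.factorial * m) := by
    calc _ ≤ |S| ^ 2 := by gcongr
      _ = S ^ 2 := sq_abs S
      _ ≤ _ := hCS
      _ ≤ _ := by gcongr
  have h3 : ((n.factorial : ℝ) * (m : ℝ) ^ k) ^ 2 =
      ((m : ℝ) ^ (2 * k - 1) * n.factorial) * (n.factorial * m) := by
    have : ((m : ℝ) ^ k) ^ 2 = m ^ (2 * k - 1) * m := by
      rw [← pow_mul, ← pow_succ]; congr 1; omega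
    rw [mul_pow, this]; ring
  rw [h3] at h2
  exact le_of_mul_le_mul_right h2 (by positivity)

/-- For a fixed pattern `q` of length `k ≥ 2`, there is a positive constant `C` such that
for all sufficiently large `n`, the standard deviation `σ_n = sqrt (Var X_n)` of the number
of occurrences of `q` in a uniformly random permutation of length `n` satisfies
`σ_n > C * n ^ (k - 1/2)`. -/
theorem stddev_occurrences_lower_bound (k : ℕ) (hk : 2 ≤ k) (q : Equiv.Perm (Fin k)) :
    ∃ C : ℝ, 0 < C ∧ ∀ᶠ n : ℕ in atTop,
      C * (n : ℝ) ^ ((k : ℝ) - 1 / 2) < Real.sqrt (varOcc k n q) := by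

  obtain ⟨M, hM, h⟩ := var_ge hk q
  have hMp : (0 : ℝ) < 2 * M := by
    have : (1 : ℝ) ≤ M := by exact_mod_cast hM
    linarith
  refine ⟨(1 / (2 * M) : ℝ) ^ ((k : ℝ) - 1 / 2) / 2, by positivity, ?_⟩
  filter_upwards [eventually_ge_atTop M] with n hn
  have hnp : (0 : ℝ) < n := by exact_mod_cast (lt_of_lt_of_le hM hn)
  have h1 : (1 / (2 * M) : ℝ) * n ≤ ((n / M : ℕ) : ℝ) := by
    have e1 := Nat.lt_mul_div_succ n (show 0 < M from hM)
    have e2 : 1 ≤ n / M := Nat.div_pos hn hM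
    have e3 : n ≤ 2 * M * (n / M) := by nlinarith
    have e4 : (n : ℝ) ≤ 2 * M * ((n / M : ℕ) : ℝ) := by exact_mod_cast e3
    rw [one_div, inv_mul_le_iff₀ hMp]
    exact e4
  have hx : (0 : ℝ) < (1 / (2 * M) : ℝ) * n := by positivity
  have h2 : ((1 / (2 * M) : ℝ) * n) ^ ((k : ℝ) - 1 / 2) ≤ Real.sqrt (varOcc k n q) := by
    apply Real.le_sqrt_of_sq_le
    refine le_trans ?_ (h n hn)
    refine le_trans (le_of_eq ?_) (pow_le_pow_left₀ hx.le h1 _)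
    rw [← Real.rpow_natCast, ← Real.rpow_mul hx.le, ← Real.rpow_natCast]
    congr 1
    rw [Nat.cast_sub (by omega)]
    push_cast
    ring
  refine lt_of_lt_of_le ?_ h2
  rw [Real.mul_rpow (by positivity) hnp.le]
  have h3 : (0 : ℝ) < (1 / (2 * M) : ℝ) ^ ((k : ℝ) - 1 / 2) := by positivity
  have h4 : (0 : ℝ) < (n : ℝ) ^ ((k : ℝ) - 1 / 2) := by positivity
  nlinarith [mul_pos h3 h4]
end
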